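/- arXiv:1910.04126 — 9 statements merged into one kernel-verified Lean document; each statement's English description precedes it below -/
import Mathlib

section
/- Let t > 0 and x, y ∈ ℝ, and let σ be a random variable uniformly distributed on the interval [0, t]. Then the probability that ⌊(x+σ)/t⌋ ≠ ⌊(y+σ)/t⌋ equals min(|x−y|/t, 1). -/
open MeasureTheory

/-- The uniform probability measure on the interval `[0, t]`. -/
noncomputable def unif (t : ℝ) : Measure ℝ :=
  (ENNReal.ofReal t)⁻¹ • volume.restrict (Set.Icc 0 t)

theorem unif_apply (t : ℝ) (s : Set ℝ) :
    unif t s = (ENNReal.ofReal t)⁻¹ * volume (s ∩ Set.Ico 0 t) := by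
  rw [unif, ← Measure.restrict_congr_set (Ico_ae_eq_Icc (μ := volume) (a := (0 : ℝ)) (b := t)),
    Measure.smul_apply, Measure.restrict_apply' measurableSet_Ico, smul_eq_mul]

theorem floor_div_eq_of_mem_Ico {t z : ℝ} (ht : 0 < t) {k : ℤ}
    (hz : z ∈ Set.Ico (k * t) ((k + 1) * t)) : ⌊z / t⌋ = k := by
  rw [Int.floor_eq_iff, le_div_iff₀ ht, div_lt_iff₀ ht]
  exact hz

/-- The set of shifts in one period separating two points `x ≤ y` has length
`min (y - x) t`. -/
theorem volume_floor_ne_inter_Ico {t : ℝ} (ht : 0 < t) {x y : ℝ} (hxy : x ≤ y) :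
    volume ({σ : ℝ | ⌊(x + σ) / t⌋ ≠ ⌊(y + σ) / t⌋} ∩ Set.Ico 0 t) =
      ENNReal.ofReal (min (y - x) t) := by
  rcases le_or_gt t (y - x) with h | h
  · rw [min_eq_right h, Set.inter_eq_right.2, Real.volume_Ico, sub_zero]
    intro σ _
    have h1 : ⌊(x + σ) / t⌋ + 1 ≤ ⌊(y + σ) / t⌋ := by
      rw [← Int.floor_add_one]
      apply Int.floor_le_floor
      rw [div_add_one ht.ne', div_le_div_iff_of_pos_right ht]
      linarith
    simp only [Set.mem_ofPred_eq]
    lia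
  rw [min_eq_left h.le]
  obtain ⟨m, hm0, hm1⟩ : ∃ m : ℤ, m * t ≤ x ∧ x < (m + 1) * t :=
    ⟨⌊x / t⌋, (le_div_iff₀ ht).1 (Int.floor_le _), (div_lt_iff₀ ht).1 (Int.lt_floor_add_one _)⟩
  have hx1 (σ : ℝ) (h0 : 0 ≤ σ) (h1 : σ < (m + 1) * t - x) : ⌊(x + σ) / t⌋ = m :=
    floor_div_eq_of_mem_Ico ht ⟨by linarith, by linarith⟩
  have hx2 (σ : ℝ) (h0 : (m + 1) * t - x ≤ σ) (h1 : σ < t) : ⌊(x + σ) / t⌋ = m + 1 :=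
    floor_div_eq_of_mem_Ico ht ⟨by push_cast; linarith, by push_cast; linarith⟩
  rcases lt_or_ge y ((m + 1) * t) with hy | hy
  · have hy1 (σ : ℝ) (h0 : 0 ≤ σ) (h1 : σ < (m + 1) * t - y) : ⌊(y + σ) / t⌋ = m :=
      floor_div_eq_of_mem_Ico ht ⟨by linarith, by linarith⟩
    have hy2 (σ : ℝ) (h0 : (m + 1) * t - y ≤ σ) (h1 : σ < t) : ⌊(y + σ) / t⌋ = m + 1 :=
      floor_div_eq_of_mem_Ico ht ⟨by push_cast; linarith, by push_cast; linarith⟩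
    have hS : {σ : ℝ | ⌊(x + σ) / t⌋ ≠ ⌊(y + σ) / t⌋} ∩ Set.Ico 0 t =
        Set.Ico ((m + 1) * t - y) ((m + 1) * t - x) := by
      ext σ
      simp only [Set.mem_inter_iff, Set.mem_ofPred_eq, Set.mem_Ico]
      constructor
      · rintro ⟨hne, h0, h1⟩
        by_contra! hc
        rcases lt_or_ge σ ((m + 1) * t - y) with h2 | h2
        · exact hne (by rw [hx1 σ h0 (by linarith), hy1 σ h0 h2])
        · exact hne (by rw [hx2 σ (hc h2) h1, hy2 σ h2 h1])
      · rintro ⟨h2, h3⟩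
        have h0 : 0 ≤ σ := by linarith
        have h1 : σ < t := by linarith
        refine ⟨?_, h0, h1⟩
        rw [hx1 σ h0 h3, hy2 σ h2 h1]
        lia
    rw [hS, Real.volume_Ico]
    congr 1
    ring
  · have hy1 (σ : ℝ) (h0 : 0 ≤ σ) (h1 : σ < (m + 2) * t - y) : ⌊(y + σ) / t⌋ = m + 1 :=
      floor_div_eq_of_mem_Ico ht ⟨by push_cast; linarith, by push_cast; linarith⟩
    have hy2 (σ : ℝ) (h0 : (m + 2) * t - y ≤ σ) (h1 : σ < t) : ⌊(y + σ) / t⌋ = m + 2 :=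
      floor_div_eq_of_mem_Ico ht ⟨by push_cast; linarith, by push_cast; linarith⟩
    have hS : {σ : ℝ | ⌊(x + σ) / t⌋ ≠ ⌊(y + σ) / t⌋} ∩ Set.Ico 0 t =
        Set.Ico 0 ((m + 1) * t - x) ∪ Set.Ico ((m + 2) * t - y) t := by
      ext σ
      simp only [Set.mem_inter_iff, Set.mem_ofPred_eq, Set.mem_Ico, Set.mem_union]
      constructor
      · rintro ⟨hne, h0, h1⟩
        by_contra! hc
        have h2 := hc.1 h0
        have h3 : σ < (m + 2) * t - y := by
          by_contra! h3
          linarith [hc.2 h3]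
        exact hne (by rw [hx2 σ h2 h1, hy1 σ h0 h3])
      · rintro (⟨h0, h2⟩ | ⟨h2, h1⟩)
        · refine ⟨?_, h0, by linarith⟩
          rw [hx1 σ h0 h2, hy1 σ h0 (by linarith)]
          lia
        · refine ⟨?_, by linarith, h1⟩
          rw [hx2 σ (by linarith) h1, hy2 σ h2 h1]
          lia
    have hd : Disjoint (Set.Ico 0 ((m + 1) * t - x)) (Set.Ico ((m + 2) * t - y) t) := by
      rw [Set.disjoint_left]
      rintro σ ⟨_, h1⟩ ⟨h2, _⟩
      linarith
    rw [hS, measure_union hd measurableSet_Ico, Real.volume_Ico, Real.volume_Ico,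
      ← ENNReal.ofReal_add (by linarith) (by linarith)]
    congr 1
    ring

/-- Let `t > 0` and `x, y ∈ ℝ`, and let `σ` be uniformly distributed on `[0, t]`.
Then the probability that `⌊(x+σ)/t⌋ ≠ ⌊(y+σ)/t⌋` equals `min (|x−y|/t) 1`. -/
theorem stmt0 (t : ℝ) (ht : 0 < t) (x y : ℝ) :
    unif t {σ : ℝ | ⌊(x + σ) / t⌋ ≠ ⌊(y + σ) / t⌋} =
      ENNReal.ofReal (min (|x - y| / t) 1) := by
  wlog hxy : x ≤ y generalizing x y
  · rw [abs_sub_comm, ← this y x (le_of_not_ge hxy)]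
    simp only [ne_comm]
  rw [unif_apply, volume_floor_ne_inter_Ico ht hxy, ← ENNReal.ofReal_inv_of_pos ht,
    ← ENNReal.ofReal_mul (inv_nonneg.2 ht.le), abs_sub_comm, abs_of_nonneg (sub_nonneg.2 hxy),
    mul_min_of_nonneg _ _ (inv_nonneg.2 ht.le), inv_mul_cancel₀ ht.ne', div_eq_inv_mul]
end

section
/- Let d ∈ ℕ, t > 0, and x, y ∈ ℝ^d, and let σ ∈ ℝ^d be random with i.i.d. coordinates uniformly distributed on [0, t]. Then the probability that x and y are NOT separated at scale t under σ (i.e., lie in the same grid cell) equals ∏_{i=1}^d max(0, 1 − |x_i−y_i|/t); in particular this probability is at least 1 − ‖x−y‖₁/t. -/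
open MeasureTheory

theorem unif_floor_eq_of_le {t a b : ℝ} (ht : 0 < t) (hab : a ≤ b) :
    unif t {s | ⌊(a + s) / t⌋ = ⌊(b + s) / t⌋} = ENNReal.ofReal (max 0 (1 - |a - b| / t)) := by
  set A : Set ℝ := {s | ⌊(a + s) / t⌋ = ⌊(b + s) / t⌋} with hA
  have hmeas : MeasurableSet A := measurableSet_eq_fun (by fun_prop) (by fun_prop)
  have hinv : ∀ g : AddSubgroup.zmultiples t, (fun s : ℝ => g +ᵥ s) ⁻¹' A = A := by
    rintro ⟨_, n, rfl⟩
    ext s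
    have h (c : ℝ) : (c + (n • t + s)) / t = (c + s) / t + n := by
      rw [zsmul_eq_mul]
      field_simp
      ring
    simp only [hA, Set.mem_preimage, Set.mem_ofPred_eq, AddSubgroup.vadd_def, vadd_eq_add, h,
      Int.floor_add_intCast, add_left_inj]
  have hshift : volume (A ∩ Set.Ioc 0 (0 + t)) = volume (A ∩ Set.Ioc (-a) (-a + t)) :=
    (isAddFundamentalDomain_Ioc ht 0 volume).measure_set_eq
      (isAddFundamentalDomain_Ioc ht (-a) volume) hmeas hinv
  have hinter : A ∩ Set.Ico (-a) (-a + t) = Set.Ico (-a) (t - b) := by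
    ext s
    simp only [hA, Set.mem_inter_iff, Set.mem_ofPred_eq, Set.mem_Ico]
    have hzero (h₁ : -a ≤ s) (h₂ : s < -a + t) : ⌊(a + s) / t⌋ = 0 :=
      Int.floor_eq_zero_iff.2 ⟨div_nonneg (by linarith) ht.le, (div_lt_one ht).2 (by linarith)⟩
    constructor
    · rintro ⟨h, h₁, h₂⟩
      rw [hzero h₁ h₂] at h
      have := (div_lt_one ht).1 (Int.floor_eq_zero_iff.1 h.symm).2
      exact ⟨h₁, by linarith⟩
    · rintro ⟨h₁, h₂⟩
      refine ⟨?_, h₁, by linarith⟩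
      rw [hzero h₁ (by linarith), eq_comm]
      exact Int.floor_eq_zero_iff.2
        ⟨div_nonneg (by linarith) ht.le, (div_lt_one ht).2 (by linarith)⟩
  have hvol : volume (A ∩ Set.Icc 0 t) = ENNReal.ofReal (t - b + a) := by
    calc
      volume (A ∩ Set.Icc 0 t) = volume (A ∩ Set.Ioc 0 (0 + t)) := by
        rw [zero_add]
        exact measure_congr ((ae_eq_refl A).inter Ioc_ae_eq_Icc.symm)
      _ = volume (A ∩ Set.Ioc (-a) (-a + t)) := hshift
      _ = volume (A ∩ Set.Ico (-a) (-a + t)) :=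
        measure_congr ((ae_eq_refl A).inter Ico_ae_eq_Ioc.symm)
      _ = ENNReal.ofReal (t - b + a) := by rw [hinter, Real.volume_Ico, sub_neg_eq_add]
  have hlen : 1 - |a - b| / t = t⁻¹ * (t - b + a) := by
    rw [abs_of_nonpos (sub_nonpos.2 hab)]
    field_simp
    ring
  rw [unif, Measure.smul_apply, Measure.restrict_apply hmeas, hvol, smul_eq_mul, max_comm,
    ENNReal.ofReal_max, ENNReal.ofReal_zero, max_eq_left zero_le, hlen,
    ENNReal.ofReal_mul (inv_nonneg.2 ht.le), ENNReal.ofReal_inv_of_pos ht]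

theorem unif_floor_eq {t : ℝ} (ht : 0 < t) (a b : ℝ) :
    unif t {s | ⌊(a + s) / t⌋ = ⌊(b + s) / t⌋} = ENNReal.ofReal (max 0 (1 - |a - b| / t)) := by
  rcases le_total a b with hab | hba
  · exact unif_floor_eq_of_le ht hab
  · simpa only [eq_comm, abs_sub_comm] using unif_floor_eq_of_le ht hba

theorem sigmaFinite_unif {t : ℝ} (ht : 0 < t) : SigmaFinite (unif t) := by
  have : IsFiniteMeasure (unif t) :=
    Measure.smul_finite _ (ENNReal.inv_ne_top.2 (ENNReal.ofReal_pos.2 ht).ne')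
  infer_instance

theorem one_sub_sum_le_prod_max {ι : Type*} (s : Finset ι) {c : ι → ℝ} (hc : ∀ i, 0 ≤ c i) :
    1 - ∑ i ∈ s, c i ≤ ∏ i ∈ s, max 0 (1 - c i) := by
  classical
  induction s using Finset.induction_on with
  | empty => simp
  | insert i s hi ih =>
    rw [Finset.sum_insert hi, Finset.prod_insert hi]
    have h₀ : 0 ≤ ∏ j ∈ s, max 0 (1 - c j) := Finset.prod_nonneg fun _ _ => le_max_left _ _
    have h₁ : ∏ j ∈ s, max 0 (1 - c j) ≤ 1 :=
      Finset.prod_le_one (fun _ _ => le_max_left _ _)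
        fun j _ => max_le zero_le_one (by linarith [hc j])
    nlinarith [mul_le_mul_of_nonneg_right (le_max_right 0 (1 - c i)) h₀,
      mul_nonneg (hc i) (sub_nonneg.2 h₁)]

/-- Let `t > 0` and `x, y ∈ ℝ^d`, with `σ ∈ ℝ^d` having i.i.d. coordinates uniform on `[0, t]`.
The probability that `x` and `y` lie in the same grid cell at scale `t` (i.e., are NOT
separated) equals `∏ i, max 0 (1 − |xᵢ−yᵢ|/t)`; in particular it is at least
`1 − ‖x−y‖₁/t`. -/
theorem stmt1 (d : ℕ) (t : ℝ) (ht : 0 < t) (x y : Fin d → ℝ) :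
    (Measure.pi fun _ : Fin d => unif t)
        {σ : Fin d → ℝ | ∀ i, ⌊(x i + σ i) / t⌋ = ⌊(y i + σ i) / t⌋} =
      ENNReal.ofReal (∏ i, max 0 (1 - |x i - y i| / t)) ∧
    ENNReal.ofReal (1 - (∑ i, |x i - y i|) / t) ≤
      (Measure.pi fun _ : Fin d => unif t)
        {σ : Fin d → ℝ | ∀ i, ⌊(x i + σ i) / t⌋ = ⌊(y i + σ i) / t⌋} := by
  have := sigmaFinite_unif ht
  have hprob : (Measure.pi fun _ : Fin d => unif t)
      {σ : Fin d → ℝ | ∀ i, ⌊(x i + σ i) / t⌋ = ⌊(y i + σ i) / t⌋} =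
      ENNReal.ofReal (∏ i, max 0 (1 - |x i - y i| / t)) := by
    have hpi : {σ : Fin d → ℝ | ∀ i, ⌊(x i + σ i) / t⌋ = ⌊(y i + σ i) / t⌋} =
        Set.univ.pi fun i => {s | ⌊(x i + s) / t⌋ = ⌊(y i + s) / t⌋} := by
      ext σ
      simp
    rw [hpi, Measure.pi_pi, ENNReal.ofReal_prod_of_nonneg fun _ _ => le_max_left _ _]
    exact Finset.prod_congr rfl fun i _ => unif_floor_eq ht (x i) (y i)
  refine ⟨hprob, ?_⟩
  rw [hprob, Finset.sum_div]
  exact ENNReal.ofReal_le_ofReal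
    (one_sub_sum_le_prod_max _ fun i => div_nonneg (abs_nonneg _) ht.le)
end

section
/- Let d ∈ ℕ, t > 0, and x, y ∈ ℝ^d, and let σ ∈ ℝ^d be random with i.i.d. coordinates uniformly distributed on [0, t]. Then the probability that x and y are NOT separated at scale t under σ (i.e., lie in the same grid cell) is at most exp(−‖x−y‖₁/t). -/
open MeasureTheory

/-- The shifts in `[0, t]` that put `a` and `b` in the same cell have total length at most `t - (b - a)`. -/
lemma volume_same_cell_le_sub {t : ℝ} (ht : 0 < t) (a b : ℝ) :
    volume ({s : ℝ | ⌊(a + s) / t⌋ = ⌊(b + s) / t⌋} ∩ Set.Icc 0 t) ≤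
      ENNReal.ofReal (t - (b - a)) := by
  set r : ℝ := a - ⌊a / t⌋ * t with hr
  have hr0 : 0 ≤ r := sub_nonneg.2 ((le_div_iff₀ ht).1 (Int.floor_le (a / t)))
  have hrt : r < t := by
    have := (div_lt_iff₀ ht).1 (Int.lt_floor_add_one (a / t))
    linarith
  have hsub : {s : ℝ | ⌊(a + s) / t⌋ = ⌊(b + s) / t⌋} ∩ Set.Icc 0 t ⊆
      Set.Icc 0 (t - r - (b - a)) ∪ Set.Icc (t - r) (min t (2 * t - r - (b - a))) := by
    rintro s ⟨hs, hs0, hst⟩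
    have hb := (div_lt_iff₀ ht).1 (Int.lt_floor_add_one ((b + s) / t))
    rw [← show ⌊(a + s) / t⌋ = ⌊(b + s) / t⌋ from hs] at hb
    rcases lt_or_ge s (t - r) with h | h
    · have hf : ⌊(a + s) / t⌋ = ⌊a / t⌋ := by
        rw [Int.floor_eq_iff, le_div_iff₀ ht, div_lt_iff₀ ht]
        constructor <;> linarith
      rw [hf] at hb
      exact Or.inl ⟨hs0, by linarith⟩
    · have hf : ⌊(a + s) / t⌋ = ⌊a / t⌋ + 1 := by
        rw [Int.floor_eq_iff, le_div_iff₀ ht, div_lt_iff₀ ht]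
        push_cast
        constructor <;> linarith
      rw [hf] at hb
      push_cast at hb
      exact Or.inr ⟨h, le_min hst (by linarith)⟩
  refine (measure_mono hsub).trans ((measure_union_le _ _).trans ?_)
  rw [Real.volume_Icc, Real.volume_Icc]
  rcases le_total (r + (b - a)) t with h | h
  · rw [← ENNReal.ofReal_add (by linarith)
      (sub_nonneg.2 (le_min (by linarith) (by linarith)))]
    apply ENNReal.ofReal_le_ofReal
    linarith [min_le_left t (2 * t - r - (b - a))]
  · rw [ENNReal.ofReal_of_nonpos (by linarith), zero_add]
    apply ENNReal.ofReal_le_ofReal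
    linarith [min_le_right t (2 * t - r - (b - a))]

lemma volume_same_cell_le {t : ℝ} (ht : 0 < t) (a b : ℝ) :
    volume ({s : ℝ | ⌊(a + s) / t⌋ = ⌊(b + s) / t⌋} ∩ Set.Icc 0 t) ≤
      ENNReal.ofReal (t - |a - b|) := by
  rcases le_total a b with h | h
  · rw [abs_sub_comm, abs_of_nonneg (sub_nonneg.2 h)]
    exact volume_same_cell_le_sub ht a b
  · rw [abs_of_nonneg (sub_nonneg.2 h)]
    simpa only [eq_comm] using volume_same_cell_le_sub ht b a

lemma unif_same_cell_le {t : ℝ} (ht : 0 < t) (a b : ℝ) :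
    unif t {s : ℝ | ⌊(a + s) / t⌋ = ⌊(b + s) / t⌋} ≤
      ENNReal.ofReal (Real.exp (-|a - b| / t)) := by
  rw [unif, Measure.smul_apply, Measure.restrict_apply' measurableSet_Icc, smul_eq_mul,
    ← ENNReal.ofReal_inv_of_pos ht]
  refine (mul_le_mul_right (volume_same_cell_le ht a b) _).trans ?_
  rw [← ENNReal.ofReal_mul (inv_nonneg.2 ht.le)]
  apply ENNReal.ofReal_le_ofReal
  calc t⁻¹ * (t - |a - b|) = -|a - b| / t + 1 := by field_simp; ring
    _ ≤ _ := Real.add_one_le_exp _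

lemma isFiniteMeasure_unif {t : ℝ} (ht : 0 < t) : IsFiniteMeasure (unif t) := by
  unfold unif
  exact Measure.smul_finite _ (ENNReal.inv_ne_top.2 (ENNReal.ofReal_pos.2 ht).ne')

/-- Let `t > 0` and `x, y ∈ ℝ^d`, with `σ ∈ ℝ^d` having i.i.d. coordinates uniform on `[0, t]`.
The probability that `x` and `y` lie in the same grid cell at scale `t` (i.e., are NOT
separated) is at most `exp (−‖x−y‖₁/t)`. -/
theorem stmt2 (d : ℕ) (t : ℝ) (ht : 0 < t) (x y : Fin d → ℝ) :
    (Measure.pi fun _ : Fin d => unif t)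
        {σ : Fin d → ℝ | ∀ i, ⌊(x i + σ i) / t⌋ = ⌊(y i + σ i) / t⌋} ≤
      ENNReal.ofReal (Real.exp (-(∑ i, |x i - y i|) / t)) := by
  have := isFiniteMeasure_unif ht
  have hset : {σ : Fin d → ℝ | ∀ i, ⌊(x i + σ i) / t⌋ = ⌊(y i + σ i) / t⌋} =
      Set.univ.pi fun i => {s : ℝ | ⌊(x i + s) / t⌋ = ⌊(y i + s) / t⌋} := by
    ext σ
    simp
  rw [hset, Measure.pi_pi, ← Finset.sum_neg_distrib, Finset.sum_div, Real.exp_sum,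
    ENNReal.ofReal_prod_of_nonneg fun i _ => (Real.exp_pos _).le]
  exact Finset.prod_le_prod' fun i _ => unif_same_cell_le ht (x i) (y i)
end

section
/- Let d ∈ ℕ, let M ≥ 0 be an integer, and let σ ∈ ℝ^d be random with i.i.d. coordinates uniformly distributed on [0, 2^M]. Then for all x, y ∈ ℝ^d with ‖x−y‖₁ ≥ 1, the expected quadtree distance satisfies E_σ[T_σ(x,y)] ≤ 2·(M+3)·‖x−y‖₁. -/
open MeasureTheory
open scoped Classical

/-- `x` and `y` are separated at level `ℓ` under the shift `σ`: some coordinate of their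
grid cells of side `2^ℓ` (after shifting by `σ`) differs. -/
def Separated (d : ℕ) (σ : Fin d → ℝ) (ℓ : ℤ) (x y : Fin d → ℝ) : Prop :=
  ∃ i, ⌊(x i + σ i) / (2 : ℝ) ^ ℓ⌋ ≠ ⌊(y i + σ i) / (2 : ℝ) ^ ℓ⌋

/-- The quadtree distance `T_σ(x,y) = 2 ⬝ Σ_{ℓ ≤ M} 2^ℓ ⬝ 1[x, y separated at level ℓ]`. -/
noncomputable def quadDist (d : ℕ) (M : ℤ) (σ x y : Fin d → ℝ) : ℝ :=
  2 * ∑' ℓ : ℤ, if ℓ ≤ M ∧ Separated d σ ℓ x y then (2 : ℝ) ^ ℓ else 0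

/-- Dyadic scales below `1` add up to `1`. -/
theorem hasSum_zpow_two_of_neg :
    HasSum (fun ℓ : ℤ => if ℓ < 0 then (2 : ℝ) ^ ℓ else 0) 1 := by
  have h1 : HasSum (fun n : ℕ => if ((n : ℤ)) < 0 then (2 : ℝ) ^ (n : ℤ) else 0) 0 := by
    convert hasSum_zero with n
    simp
  have h2 : HasSum
      (fun n : ℕ => if (-((n : ℤ) + 1)) < 0 then (2 : ℝ) ^ (-((n : ℤ) + 1)) else 0) 1 := by
    convert hasSum_geometric_two' (1 : ℝ) using 2 with n
    rw [if_pos (by omega), zpow_neg, zpow_add_one₀ two_ne_zero, zpow_natCast]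
    field_simp
  simpa using HasSum.of_nat_of_neg_add_one
    (f := fun ℓ : ℤ => if ℓ < 0 then (2 : ℝ) ^ ℓ else 0) h1 h2

/-- The indicator that `a + s` and `b + s` lie in different cells of the grid of width `w`. -/
noncomputable def cellSep (w a b s : ℝ) : ℝ :=
  if ⌊(a + s) / w⌋ ≠ ⌊(b + s) / w⌋ then 1 else 0

theorem cellSep_nonneg (w a b s : ℝ) : 0 ≤ cellSep w a b s := by
  unfold cellSep; split_ifs <;> norm_num

theorem cellSep_le_one (w a b s : ℝ) : cellSep w a b s ≤ 1 := by
  unfold cellSep; split_ifs <;> norm_num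

theorem cellSep_comm (w a b s : ℝ) : cellSep w a b s = cellSep w b a s := by
  simp only [cellSep, ne_comm]

theorem measurable_cellSep (w a b : ℝ) : Measurable (cellSep w a b) := by
  refine Measurable.ite ?_ measurable_const measurable_const
  exact (measurableSet_eq_fun (by fun_prop) (by fun_prop)).compl

theorem integrable_cellSep (w a b : ℝ) (μ : Measure ℝ) [IsFiniteMeasure μ] :
    Integrable (cellSep w a b) μ :=
  Integrable.of_bound (measurable_cellSep w a b).aestronglyMeasurable 1 <| by
    filter_upwards with s
    rw [Real.norm_of_nonneg (cellSep_nonneg ..)]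
    exact cellSep_le_one ..

theorem monotone_floor_div {w : ℝ} (hw : 0 < w) : Monotone fun s : ℝ => (⌊s / w⌋ : ℝ) := by
  intro s t h
  have : ⌊s / w⌋ ≤ ⌊t / w⌋ := by gcongr
  exact Int.cast_le.2 this

theorem intervalIntegrable_floor_add_div {w : ℝ} (hw : 0 < w) (c p q : ℝ) :
    IntervalIntegrable (fun s : ℝ => (⌊(c + s) / w⌋ : ℝ)) volume p q :=
  Monotone.intervalIntegrable fun _ _ h => monotone_floor_div hw (by linarith)

/-- Over a whole number `N` of cells, the floor function shifted by `b` exceeds the one shifted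
by `a` by `N * (b - a)` in the mean. -/
theorem integral_floor_div_sub {w : ℝ} (hw : 0 < w) (N : ℕ) (a b : ℝ) :
    ∫ s in (0 : ℝ)..(N * w), ((⌊(b + s) / w⌋ : ℝ) - ⌊(a + s) / w⌋) = N * (b - a) := by
  have hf : ∀ c d, IntervalIntegrable (fun s : ℝ => (⌊s / w⌋ : ℝ)) volume c d :=
    fun c d => (monotone_floor_div hw).intervalIntegrable
  have hc : ∀ c : ℝ, ∫ s in (0 : ℝ)..(N * w), (⌊(c + s) / w⌋ : ℝ)
      = ∫ s in c..(c + N * w), (⌊s / w⌋ : ℝ) := by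
    intro c
    simpa using intervalIntegral.integral_comp_add_left
      (a := 0) (b := N * w) (fun s : ℝ => (⌊s / w⌋ : ℝ)) c
  have hshift : ∫ s in (a + N * w)..(b + N * w), (⌊s / w⌋ : ℝ)
      = (∫ s in a..b, (⌊s / w⌋ : ℝ)) + N * (b - a) := by
    rw [← intervalIntegral.integral_comp_add_right (fun s : ℝ => (⌊s / w⌋ : ℝ)) (N * w)]
    have : ∀ s : ℝ, (⌊(s + N * w) / w⌋ : ℝ) = ⌊s / w⌋ + N := by
      intro s
      rw [add_div, mul_div_cancel_right₀ _ hw.ne', Int.floor_add_natCast]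
      push_cast
      rfl
    simp only [this]
    rw [intervalIntegral.integral_add (hf a b) intervalIntegrable_const]
    simp [mul_comm]
  rw [intervalIntegral.integral_sub (intervalIntegrable_floor_add_div hw b _ _)
    (intervalIntegrable_floor_add_div hw a _ _), hc, hc]
  have h1 := intervalIntegral.integral_add_adjacent_intervals (hf a b) (hf b (b + N * w))
  have h2 := intervalIntegral.integral_add_adjacent_intervals
    (hf a (a + N * w)) (hf (a + N * w) (b + N * w))
  linarith

theorem intervalIntegral_cellSep_le {w : ℝ} (hw : 0 < w) (N : ℕ) (a b : ℝ) :
    ∫ s in (0 : ℝ)..(N * w), cellSep w a b s ≤ N * |a - b| := by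
  wlog hab : a ≤ b generalizing a b
  · simpa only [cellSep_comm w a b, abs_sub_comm a b] using this b a (le_of_not_ge hab)
  rw [abs_sub_comm, abs_of_nonneg (sub_nonneg.2 hab), ← integral_floor_div_sub hw]
  refine intervalIntegral.integral_mono_on (by positivity) ?_ ((intervalIntegrable_floor_add_div hw b _ _).sub
    (intervalIntegrable_floor_add_div hw a _ _)) ?_
  · rw [intervalIntegrable_iff_integrableOn_Ioc_of_le (by positivity)]
    exact integrable_cellSep w a b _
  · intro s _
    have h : ⌊(a + s) / w⌋ ≤ ⌊(b + s) / w⌋ := by gcongr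
    unfold cellSep
    split_ifs with hne
    · have : ⌊(a + s) / w⌋ + 1 ≤ ⌊(b + s) / w⌋ := by omega
      have : (⌊(a + s) / w⌋ : ℝ) + 1 ≤ ⌊(b + s) / w⌋ := by exact_mod_cast this
      linarith
    · have : (⌊(a + s) / w⌋ : ℝ) ≤ ⌊(b + s) / w⌋ := by exact_mod_cast h
      linarith

theorem isProbabilityMeasure_unif {t : ℝ} (ht : 0 < t) : IsProbabilityMeasure (unif t) := by
  constructor
  simp only [unif, Measure.smul_apply, Measure.restrict_apply MeasurableSet.univ,
    Set.univ_inter, Real.volume_Icc, sub_zero, smul_eq_mul]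
  exact ENNReal.inv_mul_cancel (by simpa using ht) ENNReal.ofReal_ne_top

theorem integral_unif {t : ℝ} (ht : 0 < t) (f : ℝ → ℝ) :
    ∫ s, f s ∂unif t = t⁻¹ * ∫ s in (0 : ℝ)..t, f s := by
  rw [unif, integral_smul_measure, integral_Icc_eq_integral_Ioc,
    intervalIntegral.integral_of_le ht.le, ENNReal.toReal_inv, ENNReal.toReal_ofReal ht.le,
    smul_eq_mul]

/-- A random shift separates `a` and `b` at level `ℓ` with probability at most
`|a - b| / 2 ^ ℓ`. -/
theorem zpow_mul_integral_cellSep_le {M ℓ : ℤ} (hℓ : ℓ ≤ M) (a b : ℝ) :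
    (2 : ℝ) ^ ℓ * ∫ s, cellSep ((2 : ℝ) ^ ℓ) a b s ∂unif ((2 : ℝ) ^ M) ≤ |a - b| := by
  obtain ⟨k, rfl⟩ := Int.le.dest hℓ
  have hw : (0 : ℝ) < 2 ^ ℓ := by positivity
  have hM : (2 : ℝ) ^ (ℓ + k) = ((2 ^ k : ℕ) : ℝ) * 2 ^ ℓ := by
    rw [zpow_add₀ two_ne_zero, zpow_natCast]
    push_cast
    ring
  have hN : (0 : ℝ) < ((2 ^ k : ℕ) : ℝ) := by positivity
  rw [integral_unif (by positivity), hM]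
  have h := intervalIntegral_cellSep_le hw (2 ^ k) a b
  generalize ((2 ^ k : ℕ) : ℝ) = N at *
  calc _ = N⁻¹ * ∫ s in (0 : ℝ)..(N * 2 ^ ℓ), cellSep (2 ^ ℓ) a b s := by
        field_simp
    _ ≤ N⁻¹ * (N * |a - b|) := by gcongr
    _ = |a - b| := by field_simp

theorem quadDist_nonneg (d : ℕ) (M : ℤ) (σ x y : Fin d → ℝ) : 0 ≤ quadDist d M σ x y := by
  refine mul_nonneg two_pos.le (tsum_nonneg fun ℓ => ?_)
  split_ifs <;> positivity

theorem ite_separated_le_sum_cellSep (d : ℕ) (σ x y : Fin d → ℝ) (ℓ : ℤ) :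
    (if Separated d σ ℓ x y then (1 : ℝ) else 0) ≤
      ∑ i, cellSep ((2 : ℝ) ^ ℓ) (x i) (y i) (σ i) := by
  split_ifs with h
  · obtain ⟨i, hi⟩ := h
    calc (1 : ℝ) = cellSep ((2 : ℝ) ^ ℓ) (x i) (y i) (σ i) := by simp [cellSep, hi]
      _ ≤ _ := Finset.single_le_sum
        (f := fun i => cellSep ((2 : ℝ) ^ ℓ) (x i) (y i) (σ i))
        (fun j _ => cellSep_nonneg ..) (Finset.mem_univ i)
  · exact Finset.sum_nonneg fun j _ => cellSep_nonneg ..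

/-- The levels below `0` contribute at most `1` to the sum defining the quadtree distance. -/
theorem quadDist_le (d : ℕ) (M : ℤ) (σ x y : Fin d → ℝ) :
    quadDist d M σ x y ≤ 2 * (1 + ∑ ℓ ∈ Finset.Icc 0 M, ∑ i,
      (2 : ℝ) ^ ℓ * cellSep ((2 : ℝ) ^ ℓ) (x i) (y i) (σ i)) := by
  set F : ℤ → ℝ := fun ℓ => ∑ i, (2 : ℝ) ^ ℓ * cellSep ((2 : ℝ) ^ ℓ) (x i) (y i) (σ i) with hF
  have hF0 : ∀ ℓ, 0 ≤ F ℓ := fun ℓ =>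
    Finset.sum_nonneg fun i _ => mul_nonneg (by positivity) (cellSep_nonneg ..)
  have hsum : HasSum (fun ℓ => if ℓ ∈ Finset.Icc 0 M then F ℓ else 0)
      (∑ ℓ ∈ Finset.Icc 0 M, F ℓ) := by
    have h : HasSum _ _ := hasSum_sum_of_ne_finset_zero
      (f := fun ℓ => if ℓ ∈ Finset.Icc 0 M then F ℓ else 0) (s := Finset.Icc 0 M)
      fun ℓ hℓ => if_neg hℓ
    rwa [Finset.sum_congr rfl fun ℓ hℓ => if_pos hℓ] at h
  have htot := hasSum_zpow_two_of_neg.add hsum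
  have hle : ∀ ℓ : ℤ, (if ℓ ≤ M ∧ Separated d σ ℓ x y then (2 : ℝ) ^ ℓ else 0) ≤
      (if ℓ < 0 then (2 : ℝ) ^ ℓ else 0) + (if ℓ ∈ Finset.Icc 0 M then F ℓ else 0) := by
    intro ℓ
    have hp : (0 : ℝ) < 2 ^ ℓ := by positivity
    by_cases hc : ℓ ≤ M ∧ Separated d σ ℓ x y
    · rw [if_pos hc]
      rcases lt_or_ge ℓ 0 with h0 | h0
      · simp [h0, h0.not_ge]
      · have h := ite_separated_le_sum_cellSep d σ x y ℓ
        rw [if_pos hc.2] at h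
        rw [if_neg h0.not_gt, if_pos (Finset.mem_Icc.2 ⟨h0, hc.1⟩), zero_add]
        simp only [hF]
        rw [← Finset.mul_sum]
        exact le_mul_of_one_le_right hp.le h
    · rw [if_neg hc]
      have := hF0 ℓ
      split_ifs <;> linarith
  have hsm : Summable fun ℓ : ℤ =>
      if ℓ ≤ M ∧ Separated d σ ℓ x y then (2 : ℝ) ^ ℓ else 0 :=
    Summable.of_nonneg_of_le (fun ℓ => by split_ifs <;> positivity) hle htot.summable
  exact mul_le_mul_of_nonneg_left (hasSum_le hle hsm.hasSum htot) two_pos.le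

/-- For `M ≥ 0` and `σ ∈ ℝ^d` with i.i.d. coordinates uniform on `[0, 2^M]`, for all
`x, y ∈ ℝ^d` with `‖x−y‖₁ ≥ 1`, the expected quadtree distance satisfies
`E_σ[T_σ(x,y)] ≤ 2(M+3)‖x−y‖₁`. -/
theorem stmt3 (d : ℕ) (M : ℤ) (hM : 0 ≤ M) (x y : Fin d → ℝ)
    (hxy : 1 ≤ ∑ i, |x i - y i|) :
    ∫ σ, quadDist d M σ x y ∂(Measure.pi fun _ : Fin d => unif ((2 : ℝ) ^ M)) ≤
      2 * ((M : ℝ) + 3) * ∑ i, |x i - y i| := by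
  have := isProbabilityMeasure_unif (show (0 : ℝ) < 2 ^ M by positivity)
  set ν := unif ((2 : ℝ) ^ M)
  set S := ∑ i, |x i - y i|
  have hmp : ∀ i, MeasurePreserving (Function.eval i) (Measure.pi fun _ : Fin d => ν) ν :=
    fun i => measurePreserving_eval (fun _ : Fin d => ν) i
  have hterm : ∀ (ℓ : ℤ) (i : Fin d), Integrable
      (fun σ : Fin d → ℝ => (2 : ℝ) ^ ℓ * cellSep ((2 : ℝ) ^ ℓ) (x i) (y i) (σ i))
      (Measure.pi fun _ => ν) := fun ℓ i =>
    ((hmp i).integrable_comp_of_integrable (integrable_cellSep _ _ _ ν)).const_mul _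
  have hrow : ∀ ℓ : ℤ, Integrable
      (fun σ : Fin d → ℝ => ∑ i, (2 : ℝ) ^ ℓ * cellSep ((2 : ℝ) ^ ℓ) (x i) (y i) (σ i))
      (Measure.pi fun _ => ν) := fun ℓ => integrable_finsetSum _ fun i _ => hterm ℓ i
  have hsum : Integrable (fun σ : Fin d → ℝ => ∑ ℓ ∈ Finset.Icc 0 M,
      ∑ i, (2 : ℝ) ^ ℓ * cellSep ((2 : ℝ) ^ ℓ) (x i) (y i) (σ i))
      (Measure.pi fun _ => ν) := integrable_finsetSum _ fun ℓ _ => hrow ℓ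
  have hlevel : ∀ ℓ ∈ Finset.Icc 0 M, ∫ σ : Fin d → ℝ,
      ∑ i, (2 : ℝ) ^ ℓ * cellSep ((2 : ℝ) ^ ℓ) (x i) (y i) (σ i)
        ∂(Measure.pi fun _ => ν) ≤ S := by
    intro ℓ hℓ
    rw [integral_finsetSum _ fun i _ => hterm ℓ i]
    refine Finset.sum_le_sum fun i _ => ?_
    have hmap : ∫ σ : Fin d → ℝ, cellSep ((2 : ℝ) ^ ℓ) (x i) (y i) (σ i)
        ∂(Measure.pi fun _ => ν) = ∫ s, cellSep ((2 : ℝ) ^ ℓ) (x i) (y i) s ∂ν := by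
      have h := integral_map (μ := Measure.pi fun _ => ν) (hmp i).measurable.aemeasurable
        (measurable_cellSep ((2 : ℝ) ^ ℓ) (x i) (y i)).aestronglyMeasurable
      rw [(hmp i).map_eq] at h
      exact h.symm
    rw [integral_const_mul, hmap]
    exact zpow_mul_integral_cellSep_le (Finset.mem_Icc.1 hℓ).2 (x i) (y i)
  have hcard : ((Finset.Icc 0 M).card : ℝ) = M + 1 := by
    have : ((Finset.Icc 0 M).card : ℤ) = M + 1 := by
      rw [Int.card_Icc]
      omega
    exact_mod_cast this
  calc ∫ σ, quadDist d M σ x y ∂(Measure.pi fun _ => ν)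
      ≤ ∫ σ, 2 * (1 + ∑ ℓ ∈ Finset.Icc 0 M, ∑ i,
          (2 : ℝ) ^ ℓ * cellSep ((2 : ℝ) ^ ℓ) (x i) (y i) (σ i))
          ∂(Measure.pi fun _ => ν) :=
        integral_mono_of_nonneg (.of_forall fun σ => quadDist_nonneg d M σ x y)
          (((integrable_const 1).add hsum).const_mul 2)
          (.of_forall fun σ => quadDist_le d M σ x y)
    _ = 2 * (1 + ∑ ℓ ∈ Finset.Icc 0 M, ∫ σ : Fin d → ℝ, ∑ i,
          (2 : ℝ) ^ ℓ * cellSep ((2 : ℝ) ^ ℓ) (x i) (y i) (σ i)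
          ∂(Measure.pi fun _ => ν)) := by
        rw [integral_const_mul, integral_add (integrable_const 1) hsum,
          integral_finsetSum _ fun ℓ _ => hrow ℓ]
        simp
    _ ≤ 2 * (1 + (M + 1) * S) := by
        have := Finset.sum_le_card_nsmul _ _ _ hlevel
        rw [nsmul_eq_mul, hcard] at this
        gcongr
    _ ≤ 2 * ((M : ℝ) + 3) * S := by linarith
end

section
/- Let d ∈ ℕ, let M be an integer, and let σ ∈ ℝ^d be random with i.i.d. coordinates uniformly distributed on [0, 2^M]. Then for every λ ≥ 1 and all x, y ∈ ℝ^d with 0 < ‖x−y‖₁ ≤ λ·2^M, the probability that T_σ(x,y) < ‖x−y‖₁/λ is at most e^{−λ}. -/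
open MeasureTheory
open scoped Classical

/-- Two points at distance `|a - b|` fall into the same cell of a grid of side `h`, shifted uniformly
over a whole number of cells, with probability at most `exp (-(|a - b| / h))`. -/
theorem unif_floor_eq_le (a b h : ℝ) (hh : 0 < h) (N : ℕ) (hN : 0 < N) :
    unif (N * h) {s : ℝ | ⌊(a + s) / h⌋ = ⌊(b + s) / h⌋} ≤
      ENNReal.ofReal (Real.exp (-(|a - b| / h))) := by
  wlog hab : a ≤ b generalizing a b
  · have := this b a (le_of_not_ge hab)
    rw [abs_sub_comm]
    simpa only [eq_comm] using this
  set S : Set ℝ := {s : ℝ | ⌊(a + s) / h⌋ = ⌊(b + s) / h⌋} with hS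
  have hSm : MeasurableSet S :=
    measurableSet_eq_fun (Int.measurable_floor.comp (by fun_prop))
      (Int.measurable_floor.comp (by fun_prop))
  have hNh : 0 < (N : ℝ) * h := by positivity
  have hper : Function.Periodic (S.indicator (1 : ℝ → ℝ)) h := by
    intro s
    have key : ∀ c : ℝ, ⌊(c + (s + h)) / h⌋ = ⌊(c + s) / h⌋ + 1 := fun c => by
      rw [← Int.floor_add_one]
      congr 1
      field_simp
      ring
    have hmem : s + h ∈ S ↔ s ∈ S := by simp [hS, key]
    simp [Set.indicator_apply, hmem]
  have hint : ∀ t₁ t₂, IntervalIntegrable (S.indicator (1 : ℝ → ℝ)) volume t₁ t₂ := fun t₁ t₂ => by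
    rw [intervalIntegrable_iff]
    exact (integrableOn_const (C := (1 : ℝ)) (by simp)).indicator hSm
  have hval : ∀ t u : ℝ, t ≤ u →
      ∫ s in t..u, S.indicator (1 : ℝ → ℝ) s = volume.real (S ∩ Set.Ioc t u) := fun t u htu => by
    rw [intervalIntegral.integral_of_le htu, integral_indicator_one hSm,
      measureReal_restrict_apply hSm]
  have hsum := hper.intervalIntegral_add_zsmul_eq N 0 hint
  rw [hper.intervalIntegral_add_eq 0 (-b), hval (-b) _ (by linarith), hval 0 _ (by simpa using hNh.le)]
    at hsum
  have hcell : volume.real (S ∩ Set.Ioc (-b) (-b + h)) ≤ h * Real.exp (-(|a - b| / h)) := by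
    have hsub : S ∩ Set.Ioc (-b) (-b + h) ⊆ Set.Icc (-a) (-b + h) := by
      rintro s ⟨hs, hs1, hs2⟩
      refine ⟨?_, hs2⟩
      have hb : 0 ≤ ⌊(b + s) / h⌋ := Int.floor_nonneg.2 (div_nonneg (by linarith) hh.le)
      have hs' : ⌊(a + s) / h⌋ = ⌊(b + s) / h⌋ := hs
      rw [← hs', Int.floor_nonneg, le_div_iff₀ hh] at hb
      linarith
    refine (measureReal_mono hsub (by simp)).trans ?_
    rw [Real.volume_real_Icc, abs_of_nonpos (by linarith)]
    refine max_le ?_ (by positivity)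
    have := mul_le_mul_of_nonneg_left (Real.add_one_le_exp (-(-(a - b) / h))) hh.le
    refine le_trans (le_of_eq ?_) this
    field_simp
    ring
  have hIcc : volume (S ∩ Set.Icc 0 (N * h)) =
      ENNReal.ofReal (N * volume.real (S ∩ Set.Ioc (-b) (-b + h))) := by
    rw [← Measure.restrict_apply hSm, ← restrict_Ioc_eq_restrict_Icc, Measure.restrict_apply hSm,
      ← ofReal_measureReal (measure_ne_top_of_subset Set.inter_subset_right measure_Ioc_lt_top.ne)]
    congr 1
    simpa using hsum
  rw [unif, Measure.smul_apply, Measure.restrict_apply hSm, hIcc, smul_eq_mul,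
    ← ENNReal.ofReal_inv_of_pos hNh, ← ENNReal.ofReal_mul (by positivity)]
  refine ENNReal.ofReal_le_ofReal ?_
  rw [inv_mul_le_iff₀ hNh, mul_assoc]
  gcongr

instance isFiniteMeasure_unif_zpow (M : ℤ) : IsFiniteMeasure (unif ((2 : ℝ) ^ M)) := by
  have h : (0 : ℝ) < 2 ^ M := by positivity
  exact Measure.smul_finite _ (by simp [h])

/-- The quadtree distance is at least twice the side of any cell level separating the points. -/
theorem two_mul_zpow_le_quadDist {d : ℕ} {M ℓ : ℤ} {σ x y : Fin d → ℝ} (hℓ : ℓ ≤ M)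
    (hsep : Separated d σ ℓ x y) : 2 * (2 : ℝ) ^ ℓ ≤ quadDist d M σ x y := by
  have hgeom : Summable fun k : ℤ => if k ≤ M then (2 : ℝ) ^ k else 0 := by
    have hinj : Function.Injective fun n : ℕ => M - (n : ℤ) := fun m n hmn => by
      simpa using hmn
    rw [← hinj.summable_iff]
    · refine (summable_geometric_two.mul_left ((2 : ℝ) ^ M)).congr fun n => ?_
      simp [zpow_sub₀, div_eq_mul_inv]
    · intro k hk
      refine if_neg fun hkM => hk ⟨(M - k).toNat, ?_⟩
      simp only
      omega
  have hsum : Summable fun k : ℤ => if k ≤ M ∧ Separated d σ k x y then (2 : ℝ) ^ k else 0 := by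
    refine hgeom.of_nonneg_of_le (fun k => by positivity) fun k => ?_
    split_ifs with h₁ h₂
    · exact le_rfl
    · exact absurd h₁.1 h₂
    · positivity
    · exact le_rfl
  have hle := hsum.le_tsum ℓ fun k _ => by positivity
  rw [if_pos ⟨hℓ, hsep⟩] at hle
  unfold quadDist
  gcongr

/-- For any integer `M` and `σ ∈ ℝ^d` with i.i.d. coordinates uniform on `[0, 2^M]`:
for every `λ ≥ 1` and all `x, y ∈ ℝ^d` with `0 < ‖x−y‖₁ ≤ λ·2^M`, the probability that
`T_σ(x,y) < ‖x−y‖₁/λ` is at most `exp (−λ)`. -/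
theorem stmt4 (d : ℕ) (M : ℤ) (lam : ℝ) (hlam : 1 ≤ lam) (x y : Fin d → ℝ)
    (h0 : 0 < ∑ i, |x i - y i|) (h1 : ∑ i, |x i - y i| ≤ lam * (2 : ℝ) ^ M) :
    (Measure.pi fun _ : Fin d => unif ((2 : ℝ) ^ M))
        {σ : Fin d → ℝ | quadDist d M σ x y < (∑ i, |x i - y i|) / lam} ≤
      ENNReal.ofReal (Real.exp (-lam)) := by
  have hlam0 : 0 < lam := by linarith
  set r := ∑ i, |x i - y i| with hr
  obtain ⟨ℓ, hℓ, hℓ'⟩ := exists_mem_Ico_zpow (div_pos h0 hlam0) (one_lt_two (α := ℝ))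
  have hℓM : ℓ ≤ M := by
    rw [← zpow_le_zpow_iff_right₀ (one_lt_two (α := ℝ))]
    exact hℓ.trans ((div_le_iff₀' hlam0).2 h1)
  have hpow : (0 : ℝ) < 2 ^ ℓ := by positivity
  have hM : (2 : ℝ) ^ M = ((2 ^ (M - ℓ).toNat : ℕ) : ℝ) * 2 ^ ℓ := by
    push_cast
    rw [← zpow_natCast, ← zpow_add₀ two_ne_zero]
    congr 1
    omega
  have hsub : {σ : Fin d → ℝ | quadDist d M σ x y < r / lam} ⊆ Set.univ.pi fun i =>
      {s : ℝ | ⌊(x i + s) / (2 : ℝ) ^ ℓ⌋ = ⌊(y i + s) / (2 : ℝ) ^ ℓ⌋} := by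
    intro σ hσ i _
    by_contra hne
    have hT := two_mul_zpow_le_quadDist hℓM (σ := σ) (x := x) (y := y) ⟨i, hne⟩
    rw [zpow_add_one₀ two_ne_zero] at hℓ'
    rw [Set.mem_ofPred_eq] at hσ
    linarith
  refine (measure_mono hsub).trans ?_
  rw [Measure.pi_pi]
  calc _ ≤ ∏ i, ENNReal.ofReal (Real.exp (-(|x i - y i| / (2 : ℝ) ^ ℓ))) := by
        refine Finset.prod_le_prod' fun i _ => ?_
        rw [hM]
        exact unif_floor_eq_le _ _ _ hpow _ (by positivity)
    _ = ENNReal.ofReal (Real.exp (-(r / 2 ^ ℓ))) := by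
        rw [← ENNReal.ofReal_prod_of_nonneg fun i _ => (Real.exp_pos _).le, ← Real.exp_sum,
          Finset.sum_neg_distrib, ← Finset.sum_div]
    _ ≤ _ := by
        refine ENNReal.ofReal_le_ofReal (Real.exp_le_exp.2 (neg_le_neg ?_))
        rw [le_div_iff₀ hpow]
        exact (le_div_iff₀' hlam0).1 hℓ
end

section
/- Let X be a finite set, let c, t : X×X → [0,∞) be cost functions, and let ν, μ₁, …, μ_n be distributions on X. Let μ* be a distribution among μ₁,…,μ_n minimizing W_c(·, ν). For each i, let g_i be any coupling of (μ_i, ν) minimizing Σ_{x,y} τ(x,y)·t(x,y) over couplings τ, and define the Flowtree estimate F(i) = Σ_{x,y} g_i(x,y)·c(x,y). Suppose A, B > 0 are such that: (i) c(x,y) ≤ A·t(x,y) for every x in the support of μ* and every y in the support of ν; and (ii) there exists a coupling f* of (μ*, ν) with Σ_{x,y} f*(x,y)·c(x,y) = W_c(μ*, ν) and Σ_{x,y} f*(x,y)·t(x,y) ≤ B·W_c(μ*, ν). Then every index i' minimizing F(i') over i = 1,…,n satisfies W_c(μ_{i'}, ν) ≤ A·B·W_c(μ*, ν). -/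
/-- `μ` is a probability distribution on the finite type `X`. -/
def IsDist {X : Type*} [Fintype X] (μ : X → ℝ) : Prop :=
  (∀ x, 0 ≤ μ x) ∧ ∑ x, μ x = 1

/-- `τ` is a coupling of the distributions `μ` and `ν` on the finite type `X`. -/
def IsCoupling {X : Type*} [Fintype X] (μ ν : X → ℝ) (τ : X → X → ℝ) : Prop :=
  (∀ x y, 0 ≤ τ x y) ∧ (∀ x, ∑ y, τ x y = μ x) ∧ (∀ y, ∑ x, τ x y = ν y)

/-- The optimal transport cost `W_c(μ,ν)`: the minimum of `Σ_{x,y} τ(x,y)·c(x,y)` over all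
couplings `τ` of `(μ,ν)` (expressed as an infimum; it is attained by compactness). -/
noncomputable def W {X : Type*} [Fintype X] (c : X → X → ℝ) (μ ν : X → ℝ) : ℝ :=
  sInf {v | ∃ τ, IsCoupling μ ν τ ∧ v = ∑ x, ∑ y, τ x y * c x y}

theorem IsCoupling.le_left {X : Type*} [Fintype X] {μ ν : X → ℝ} {τ : X → X → ℝ}
    (hτ : IsCoupling μ ν τ) (x y : X) : τ x y ≤ μ x := by
  rw [← hτ.2.1 x]
  exact Finset.single_le_sum (fun z _ => hτ.1 x z) (Finset.mem_univ y)

theorem IsCoupling.le_right {X : Type*} [Fintype X] {μ ν : X → ℝ} {τ : X → X → ℝ}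
    (hτ : IsCoupling μ ν τ) (x y : X) : τ x y ≤ ν y := by
  rw [← hτ.2.2 y]
  exact Finset.single_le_sum (fun z _ => hτ.1 z y) (Finset.mem_univ x)

theorem W_le_of_isCoupling {X : Type*} [Fintype X] {c : X → X → ℝ} (hc : ∀ x y, 0 ≤ c x y)
    {μ ν : X → ℝ} {τ : X → X → ℝ} (hτ : IsCoupling μ ν τ) :
    W c μ ν ≤ ∑ x, ∑ y, τ x y * c x y := by
  refine csInf_le ⟨0, ?_⟩ ⟨τ, hτ, rfl⟩
  rintro v ⟨σ, hσ, rfl⟩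
  exact Finset.sum_nonneg fun x _ => Finset.sum_nonneg fun y _ => mul_nonneg (hσ.1 x y) (hc x y)

/-- A cost comparison on the product of the supports of the marginals bounds the cost of any
coupling. -/
theorem IsCoupling.cost_le_mul_cost {X : Type*} [Fintype X] {c t : X → X → ℝ} {μ ν : X → ℝ}
    {τ : X → X → ℝ} (hτ : IsCoupling μ ν τ) {A : ℝ}
    (h : ∀ x y, 0 < μ x → 0 < ν y → c x y ≤ A * t x y) :
    ∑ x, ∑ y, τ x y * c x y ≤ A * ∑ x, ∑ y, τ x y * t x y := by
  simp only [Finset.mul_sum]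
  refine Finset.sum_le_sum fun x _ => Finset.sum_le_sum fun y _ => ?_
  rcases (hτ.1 x y).eq_or_lt with h0 | hpos
  · simp [← h0]
  · rw [mul_left_comm]
    exact mul_le_mul_of_nonneg_left
      (h x y (hpos.trans_le (hτ.le_left x y)) (hpos.trans_le (hτ.le_right x y))) hpos.le

/-- Comparison skeleton for the Flowtree nearest-neighbor guarantee: for each `i`, take a
coupling `g i` of `(μ i, ν)` minimizing the `t`-cost, and define the Flowtree estimate
`F(i) = Σ_{x,y} g_i(x,y)·c(x,y)`. If `c ≤ A·t` on the supports of the true nearest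
neighbor `μ*` and the query `ν` only, and some optimal (for `c`) coupling of `μ*` with `ν`
has `t`-cost at most `B·W_c(μ*,ν)`, then any minimizer `μ_{i'}` of `F` is an
`A·B`-approximate `c`-nearest neighbor. -/
theorem stmt7 {X : Type*} [Fintype X] (c t : X → X → ℝ)
    (hc : ∀ x y, 0 ≤ c x y) (ht : ∀ x y, 0 ≤ t x y)
    (n : ℕ) (μ : Fin n → X → ℝ) (ν : X → ℝ)
    (hμ : ∀ i, IsDist (μ i)) (hν : IsDist ν)
    (istar : Fin n) (histar : ∀ i, W c (μ istar) ν ≤ W c (μ i) ν)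
    (g : Fin n → X → X → ℝ)
    (hg : ∀ i, IsCoupling (μ i) ν (g i) ∧
      ∀ τ, IsCoupling (μ i) ν τ →
        (∑ x, ∑ y, g i x y * t x y) ≤ ∑ x, ∑ y, τ x y * t x y)
    (A B : ℝ) (hA : 0 < A) (hB : 0 < B)
    (hcomp : ∀ x y, 0 < μ istar x → 0 < ν y → c x y ≤ A * t x y)
    (hflow : ∃ f, IsCoupling (μ istar) ν f ∧
      (∑ x, ∑ y, f x y * c x y) = W c (μ istar) ν ∧
      (∑ x, ∑ y, f x y * t x y) ≤ B * W c (μ istar) ν)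
    (i' : Fin n)
    (hi' : ∀ i, (∑ x, ∑ y, g i' x y * c x y) ≤ ∑ x, ∑ y, g i x y * c x y) :
    W c (μ i') ν ≤ A * B * W c (μ istar) ν := by
  obtain ⟨f, hf, -, hft⟩ := hflow
  calc W c (μ i') ν ≤ ∑ x, ∑ y, g i' x y * c x y := W_le_of_isCoupling hc (hg i').1
    _ ≤ ∑ x, ∑ y, g istar x y * c x y := hi' istar
    _ ≤ A * ∑ x, ∑ y, g istar x y * t x y := (hg istar).1.cost_le_mul_cost hcomp
    _ ≤ A * (B * W c (μ istar) ν) :=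
      mul_le_mul_of_nonneg_left (((hg istar).2 f hf).trans hft) hA.le
    _ = A * B * W c (μ istar) ν := (mul_assoc _ _ _).symm
end

section
/- There is a universal constant C > 0 such that the following holds. Let d, s, n ∈ ℕ, let M ≥ 0 be an integer, set Φ = 2^M, and let X ⊂ [0,Φ]^d be a finite set such that ‖x−y‖₁ ≥ 1 for all distinct x, y ∈ X and ‖x−y‖₁ ≤ Φ for all x, y ∈ X. Let μ₁, …, μ_n and ν be distributions on X, each with support of size at most s. Let σ ∈ ℝ^d be random with i.i.d. coordinates uniformly distributed on [0, Φ]. Then with probability at least 0.99 over σ, the following holds simultaneously for every choice, for each i, of a coupling g_i of (μ_i, ν) minimizing Σ_{x,y} τ(x,y)·T_σ(x,y) over couplings τ: every index i' minimizing the Flowtree estimate F(i) = Σ_{x,y} g_i(x,y)·‖x−y‖₁ satisfies W₁(μ_{i'}, ν) ≤ C·(1 + ln s)·(M+1)·min_{1≤i≤n} W₁(μ_i, ν). (This is the Flowtree nearest-neighbor approximation guarantee: the Flowtree nearest neighbor is an O(log s·log Φ)-approximate nearest neighbor in W₁, with no dependence on the dataset size n.) -/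
open MeasureTheory
open scoped Classical

/-- `μ` is a probability distribution supported on the finite set `X`. -/
def IsDistOn {α : Type*} (X : Finset α) (μ : α → ℝ) : Prop :=
  (∀ a, 0 ≤ μ a) ∧ (∀ a, μ a ≠ 0 → a ∈ X) ∧ ∑ a ∈ X, μ a = 1

/-- `τ` is a coupling of the distributions `μ` and `ν`, supported on `X × X`. -/
def IsCouplingOn {α : Type*} (X : Finset α) (μ ν : α → ℝ) (τ : α → α → ℝ) : Prop :=
  (∀ a b, 0 ≤ τ a b) ∧ (∀ a b, τ a b ≠ 0 → a ∈ X ∧ b ∈ X) ∧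
    (∀ a, ∑ b ∈ X, τ a b = μ a) ∧ (∀ b, ∑ a ∈ X, τ a b = ν b)

/-- The optimal transport cost `W_c(μ,ν)` for distributions on the finite set `X`:
the minimum of `Σ_{x,y} τ(x,y)·c(x,y)` over all couplings `τ` of `(μ,ν)`
(expressed as an infimum; it is attained by compactness). -/
noncomputable def WOn {α : Type*} (X : Finset α) (c : α → α → ℝ) (μ ν : α → ℝ) : ℝ :=
  sInf {v | ∃ τ, IsCouplingOn X μ ν τ ∧ v = ∑ a ∈ X, ∑ b ∈ X, τ a b * c a b}

theorem measurableSet_floor_eq (w x y : ℝ) :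
    MeasurableSet {u : ℝ | ⌊(x + u) / w⌋ = ⌊(y + u) / w⌋} :=
  measurableSet_eq_fun (by fun_prop) (by fun_prop)

/-- Two points at distance `t` share a randomly shifted cell of side `w` for a set of shifts
of measure `max 0 (w - t)` in each period. -/
theorem integral_floor_eq_period {w x y : ℝ} (hw : 0 < w) (hxy : x ≤ y) :
    ∫ u in (-x)..(-x + w), {u : ℝ | ⌊(x + u) / w⌋ = ⌊(y + u) / w⌋}.indicator (1 : ℝ → ℝ) u
      = max 0 (w - (y - x)) := by
  rw [intervalIntegral.integral_of_le (by linarith), ← integral_Ico_eq_integral_Ioc,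
    integral_indicator_one (measurableSet_floor_eq w x y), measureReal_restrict_apply
      (measurableSet_floor_eq w x y)]
  have : {u : ℝ | ⌊(x + u) / w⌋ = ⌊(y + u) / w⌋} ∩ Set.Ico (-x) (-x + w)
      = Set.Ico (-x) (-x + (w - (y - x))) := by
    ext u
    simp only [Set.mem_inter_iff, Set.mem_ofPred_eq, Set.mem_Ico]
    have key : -x ≤ u → u < -x + w → ⌊(x + u) / w⌋ = 0 := fun h1 h2 => by
      rw [Int.floor_eq_zero_iff]
      exact ⟨div_nonneg (by linarith) hw.le, (div_lt_one hw).2 (by linarith)⟩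
    constructor
    · rintro ⟨h, h1, h2⟩
      rw [key h1 h2, eq_comm, Int.floor_eq_zero_iff] at h
      have := (div_lt_one hw).1 h.2
      exact ⟨h1, by linarith⟩
    · rintro ⟨h1, h2⟩
      refine ⟨?_, h1, by linarith⟩
      rw [key h1 (by linarith), eq_comm, Int.floor_eq_zero_iff]
      exact ⟨div_nonneg (by linarith) hw.le, (div_lt_one hw).2 (by linarith)⟩
  rw [this, Real.volume_real_Ico, max_comm]
  congr 1
  ring

theorem unif_floor_eq_of_le_s9 {w x y : ℝ} (K : ℕ) (hK : 0 < K) (hw : 0 < w) (hxy : x ≤ y) :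
    unif (K * w) {u : ℝ | ⌊(x + u) / w⌋ = ⌊(y + u) / w⌋} = ENNReal.ofReal (1 - (y - x) / w) := by
  set A := {u : ℝ | ⌊(x + u) / w⌋ = ⌊(y + u) / w⌋} with hA
  have hm : MeasurableSet A := measurableSet_floor_eq w x y
  have hK' : (0 : ℝ) < K := by exact_mod_cast hK
  have hper : Function.Periodic (A.indicator (1 : ℝ → ℝ)) w := by
    intro u
    have : u + w ∈ A ↔ u ∈ A := by
      simp only [hA, Set.mem_ofPred_eq, ← add_assoc, add_div _ w, div_self hw.ne']
      rw [Int.floor_add_one, Int.floor_add_one, add_left_inj]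
    by_cases h : u ∈ A
    · simp [Set.indicator, this, h]
    · simp [Set.indicator, this, h]
  have h_integrable : ∀ a b, IntervalIntegrable (A.indicator (1 : ℝ → ℝ)) volume a b := by
    intro a b
    rw [intervalIntegrable_iff]
    have : IsFiniteMeasure (volume.restrict (Set.uIoc a b)) := ⟨by simp [Set.uIoc]⟩
    exact (integrable_const (1 : ℝ)).indicator hm
  have h1 : ∫ u in (0 : ℝ)..(K * w), A.indicator (1 : ℝ → ℝ) u = K * max 0 (w - (y - x)) := by
    have := hper.intervalIntegral_add_zsmul_eq K 0 h_integrable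
    simp only [zero_add, natCast_zsmul, nsmul_eq_mul] at this
    rw [this, ← integral_floor_eq_period hw hxy]
    congr 1
    simpa using hper.intervalIntegral_add_eq 0 (-x)
  rw [intervalIntegral.integral_of_le (by positivity), ← integral_Icc_eq_integral_Ioc,
    integral_indicator_one hm] at h1
  have h2 : (volume.restrict (Set.Icc 0 (K * w))) A = ENNReal.ofReal (K * max 0 (w - (y - x))) := by
    rw [← h1, ofReal_measureReal]
  rw [unif, Measure.smul_apply, h2, smul_eq_mul, ← ENNReal.ofReal_inv_of_pos (by positivity),
    ← ENNReal.ofReal_mul (by positivity)]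
  have : ((K : ℝ) * w)⁻¹ * (K * max 0 (w - (y - x))) = max 0 (1 - (y - x) / w) := by
    rw [mul_max_of_nonneg _ _ hK'.le, mul_max_of_nonneg _ _ (by positivity)]
    congr 1
    · simp
    · field_simp
  rw [this]
  rcases le_total 0 (1 - (y - x) / w) with h | h
  · rw [max_eq_right h]
  · rw [max_eq_left h, ENNReal.ofReal_of_nonpos h, ENNReal.ofReal_zero]

/-- The probability that `x` and `y` fall in the same randomly shifted interval of side `2 ^ ℓ`. -/
theorem unif_floor_eq_s9 {M ℓ : ℤ} (hℓ : ℓ ≤ M) (x y : ℝ) :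
    unif ((2 : ℝ) ^ M) {u : ℝ | ⌊(x + u) / (2 : ℝ) ^ ℓ⌋ = ⌊(y + u) / (2 : ℝ) ^ ℓ⌋}
      = ENNReal.ofReal (1 - |x - y| / (2 : ℝ) ^ ℓ) := by
  obtain ⟨k, rfl⟩ := Int.le.dest hℓ
  have : (2 : ℝ) ^ (ℓ + (k : ℤ)) = ((2 ^ k : ℕ) : ℝ) * 2 ^ ℓ := by
    rw [zpow_add₀ two_ne_zero, zpow_natCast]; push_cast; ring
  rw [this]
  rcases le_total x y with h | h
  · rw [unif_floor_eq_of_le_s9 _ (by positivity) (by positivity) h, abs_sub_comm, abs_of_nonneg]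
    linarith
  · rw [abs_of_nonneg (by linarith),
      ← unif_floor_eq_of_le_s9 (2 ^ k) (by positivity) (by positivity) h]
    simp only [eq_comm]

theorem unif_floor_ne_le {M ℓ : ℤ} (hℓ : ℓ ≤ M) (x y : ℝ) :
    unif ((2 : ℝ) ^ M) {u : ℝ | ⌊(x + u) / (2 : ℝ) ^ ℓ⌋ ≠ ⌊(y + u) / (2 : ℝ) ^ ℓ⌋}
      ≤ ENNReal.ofReal (|x - y| / (2 : ℝ) ^ ℓ) := by
  have := isProbabilityMeasure_unif (t := (2 : ℝ) ^ M) (by positivity)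
  have h := prob_compl_eq_one_sub (μ := unif ((2 : ℝ) ^ M))
    (measurableSet_floor_eq ((2 : ℝ) ^ ℓ) x y)
  rw [unif_floor_eq_s9 hℓ] at h
  refine (le_of_eq h).trans ?_
  rw [tsub_le_iff_right, ← ENNReal.ofReal_one]
  refine le_trans (ENNReal.ofReal_le_ofReal (by linarith)) ENNReal.ofReal_add_le

theorem measurableSet_separated (d : ℕ) (ℓ : ℤ) (x y : Fin d → ℝ) :
    MeasurableSet {σ | Separated d σ ℓ x y} := by
  simp only [Separated, Set.ofPred_exists]
  refine MeasurableSet.iUnion fun i => MeasurableSet.compl (s := {σ : Fin d → ℝ |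
    ⌊(x i + σ i) / (2 : ℝ) ^ ℓ⌋ = ⌊(y i + σ i) / (2 : ℝ) ^ ℓ⌋}) ?_
  exact measurableSet_eq_fun (by fun_prop) (by fun_prop)

theorem measure_separated_le (d : ℕ) {M ℓ : ℤ} (hℓ : ℓ ≤ M) (x y : Fin d → ℝ) :
    (Measure.pi fun _ : Fin d => unif ((2 : ℝ) ^ M)) {σ | Separated d σ ℓ x y}
      ≤ ENNReal.ofReal ((∑ i, |x i - y i|) / (2 : ℝ) ^ ℓ) := by
  have := isProbabilityMeasure_unif (t := (2 : ℝ) ^ M) (by positivity)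
  simp only [Separated, Set.ofPred_exists]
  refine (measure_iUnion_fintype_le _ _).trans ?_
  rw [Finset.sum_div, ENNReal.ofReal_sum_of_nonneg (fun i _ => by positivity)]
  refine Finset.sum_le_sum fun i _ => ?_
  refine le_trans (le_of_eq ?_) (unif_floor_ne_le hℓ (x i) (y i))
  exact (measurePreserving_eval (fun _ : Fin d => unif ((2 : ℝ) ^ M)) i).measure_preimage
    (measurableSet_floor_eq _ _ _).compl.nullMeasurableSet

theorem measure_not_separated_le (d : ℕ) {M ℓ : ℤ} (hℓ : ℓ ≤ M) (x y : Fin d → ℝ) :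
    (Measure.pi fun _ : Fin d => unif ((2 : ℝ) ^ M)) {σ | ¬ Separated d σ ℓ x y}
      ≤ ENNReal.ofReal (Real.exp (-((∑ i, |x i - y i|) / (2 : ℝ) ^ ℓ))) := by
  have := isProbabilityMeasure_unif (t := (2 : ℝ) ^ M) (by positivity)
  have h : {σ | ¬ Separated d σ ℓ x y} = Set.univ.pi fun i =>
      {u : ℝ | ⌊(x i + u) / (2 : ℝ) ^ ℓ⌋ = ⌊(y i + u) / (2 : ℝ) ^ ℓ⌋} := by
    ext σ; simp [Separated]
  rw [h, Measure.pi_pi, Finset.sum_div, ← Finset.sum_neg_distrib, Real.exp_sum,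
    ENNReal.ofReal_prod_of_nonneg (fun i _ => (Real.exp_pos _).le)]
  refine Finset.prod_le_prod' fun i _ => ?_
  rw [unif_floor_eq_s9 hℓ]
  refine ENNReal.ofReal_le_ofReal ?_
  linarith [Real.add_one_le_exp (-(|x i - y i| / (2 : ℝ) ^ ℓ))]

theorem injective_sub_natCast (M : ℤ) : Function.Injective fun k : ℕ => M - (k : ℤ) := by
  intro a b h
  simpa using h

theorem mem_range_sub_natCast {M ℓ : ℤ} (h : ℓ ≤ M) :
    ℓ ∈ Set.range fun k : ℕ => M - (k : ℤ) := by
  obtain ⟨k, rfl⟩ := Int.le.dest h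
  exact ⟨k, by simp⟩

theorem summable_quadDist (d : ℕ) (M : ℤ) (σ x y : Fin d → ℝ) :
    Summable fun ℓ : ℤ => if ℓ ≤ M ∧ Separated d σ ℓ x y then (2 : ℝ) ^ ℓ else 0 := by
  have h : Summable fun ℓ : ℤ => if ℓ ≤ M then (2 : ℝ) ^ ℓ else 0 := by
    rw [← (injective_sub_natCast M).summable_iff]
    · refine (summable_geometric_two.mul_left ((2 : ℝ) ^ M)).congr fun k => ?_
      simp [zpow_sub₀, div_eq_mul_inv]
    · intro ℓ hℓ
      exact if_neg fun h => hℓ (mem_range_sub_natCast h)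
  refine Summable.of_nonneg_of_le (fun ℓ => ?_) (fun ℓ => ?_) h
  · split_ifs <;> positivity
  · by_cases h1 : ℓ ≤ M <;> by_cases h2 : Separated d σ ℓ x y <;> simp [h1, h2]
    positivity

theorem quadDist_self (d : ℕ) (M : ℤ) (σ x : Fin d → ℝ) : quadDist d M σ x x = 0 := by
  simp [quadDist, Separated]

theorem le_quadDist {d : ℕ} {M ℓ : ℤ} {σ x y : Fin d → ℝ} (hℓ : ℓ ≤ M)
    (h : Separated d σ ℓ x y) : 2 * (2 : ℝ) ^ ℓ ≤ quadDist d M σ x y := by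
  refine mul_le_mul_of_nonneg_left ?_ zero_le_two
  refine le_trans (le_of_eq ?_) ((summable_quadDist d M σ x y).le_tsum ℓ fun j _ => ?_)
  · rw [if_pos ⟨hℓ, h⟩]
  · split_ifs <;> positivity

theorem ofReal_quadDist (d : ℕ) (M : ℤ) (σ x y : Fin d → ℝ) :
    ENNReal.ofReal (quadDist d M σ x y) = 2 * ∑' k : ℕ,
      {σ | Separated d σ (M - k) x y}.indicator
        (fun _ => ENNReal.ofReal ((2 : ℝ) ^ (M - (k : ℤ)))) σ := by
  rw [quadDist, ENNReal.ofReal_mul zero_le_two, ENNReal.ofReal_ofNat,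
    ENNReal.ofReal_tsum_of_nonneg (fun ℓ => by split_ifs <;> positivity)
      (summable_quadDist d M σ x y), ← (injective_sub_natCast M).tsum_eq]
  · congr 2 with k
    by_cases h : Separated d σ (M - k) x y <;> simp [Set.indicator, h]
  · intro ℓ hℓ
    by_contra h
    exact hℓ (by simp [if_neg fun h' : ℓ ≤ M ∧ _ => h (mem_range_sub_natCast h'.1)])

theorem measurable_quadDist (d : ℕ) (M : ℤ) (x y : Fin d → ℝ) :
    Measurable fun σ => quadDist d M σ x y := by
  have h : (fun σ => quadDist d M σ x y) =
      fun σ => (ENNReal.ofReal (quadDist d M σ x y)).toReal := by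
    funext σ
    rw [ENNReal.toReal_ofReal (quadDist_nonneg d M σ x y)]
  rw [h]
  simp only [ofReal_quadDist]
  exact (Measurable.const_mul (Measurable.tsum fun k =>
    measurable_const.indicator (measurableSet_separated d _ x y)) 2).ennreal_toReal

theorem tsum_le_ofReal_of_geometric_tail {f : ℕ → ENNReal} {D : ℝ} (hD : 1 ≤ D) (m : ℕ)
    (hhead : ∀ k, f k ≤ ENNReal.ofReal D)
    (htail : ∀ k, f (k + (m + 1)) ≤ ENNReal.ofReal (1 / 2 / 2 ^ k)) :
    ∑' k, f k ≤ ENNReal.ofReal (2 * (m + 1) * D) := by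
  have hsum : ∑' k : ℕ, ENNReal.ofReal (1 / 2 / 2 ^ k) = ENNReal.ofReal 1 := by
    rw [← ENNReal.ofReal_tsum_of_nonneg (fun k => by positivity) (summable_geometric_two' 1),
      tsum_geometric_two' 1]
  have hfirst : ∑ k ∈ Finset.range (m + 1), f k ≤ (m + 1 : ℕ) * ENNReal.ofReal D := by
    simpa using Finset.sum_le_card_nsmul (Finset.range (m + 1)) f _ fun k _ => hhead k
  have hrest : ∑' k, f (k + (m + 1)) ≤ ENNReal.ofReal 1 :=
    (ENNReal.tsum_le_tsum htail).trans hsum.le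
  calc ∑' k, f k = ∑ k ∈ Finset.range (m + 1), f k + ∑' k, f (k + (m + 1)) :=
        (Summable.sum_add_tsum_nat_add' (f := f) ENNReal.summable).symm
    _ ≤ (m + 1 : ℕ) * ENNReal.ofReal D + ENNReal.ofReal 1 := add_le_add hfirst hrest
    _ = ENNReal.ofReal ((m + 1 : ℕ) * D + 1) := by
        rw [ENNReal.ofReal_add (by positivity) zero_le_one,
          ENNReal.ofReal_mul (by positivity), ENNReal.ofReal_natCast]
    _ ≤ _ := by
        refine ENNReal.ofReal_le_ofReal ?_
        push_cast
        have : (0 : ℝ) ≤ m := by positivity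
        nlinarith

/-- The quadtree distance exceeds the `ℓ₁` distance by a factor `O(M + 1)` in expectation. -/
theorem lintegral_quadDist_le {d : ℕ} {M : ℤ} (hM : 0 ≤ M) {x y : Fin d → ℝ}
    (hxy : x ≠ y → 1 ≤ ∑ i, |x i - y i|) :
    ∫⁻ σ, ENNReal.ofReal (quadDist d M σ x y)
        ∂(Measure.pi fun _ : Fin d => unif ((2 : ℝ) ^ M))
      ≤ ENNReal.ofReal (4 * (M + 1) * ∑ i, |x i - y i|) := by
  rcases eq_or_ne x y with rfl | hne
  · simp [quadDist_self]
  have := isProbabilityMeasure_unif (t := (2 : ℝ) ^ M) (by positivity)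
  specialize hxy hne
  obtain ⟨m, rfl⟩ := Int.eq_ofNat_of_zero_le hM
  set D := ∑ i, |x i - y i|
  have hmeas : ∀ k : ℕ, Measurable ({σ | Separated d σ ((m : ℤ) - k) x y}.indicator
      fun _ => ENNReal.ofReal ((2 : ℝ) ^ ((m : ℤ) - (k : ℤ)))) := fun k =>
    measurable_const.indicator (measurableSet_separated d _ x y)
  simp only [ofReal_quadDist]
  rw [lintegral_const_mul _ (Measurable.tsum hmeas),
    lintegral_tsum fun k => (hmeas k).aemeasurable]
  simp only [lintegral_indicator_const (measurableSet_separated d _ x y)]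
  have htsum := tsum_le_ofReal_of_geometric_tail (f := fun k : ℕ =>
      ENNReal.ofReal ((2 : ℝ) ^ ((m : ℤ) - (k : ℤ))) *
        (Measure.pi fun _ : Fin d => unif ((2 : ℝ) ^ (m : ℤ)))
          {σ | Separated d σ ((m : ℤ) - k) x y}) hxy m (fun k => ?_) (fun k => ?_)
  · refine (mul_le_mul_right htsum 2).trans (le_of_eq ?_)
    rw [← ENNReal.ofReal_ofNat 2, ← ENNReal.ofReal_mul zero_le_two]
    congr 1
    push_cast
    ring
  · refine (mul_le_mul_right (measure_separated_le d (by simp) x y) _).trans ?_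
    rw [← ENNReal.ofReal_mul (by positivity), mul_div_cancel₀ _ (by positivity)]
  · refine (mul_le_mul_right prob_le_one _).trans ?_
    rw [mul_one]
    refine ENNReal.ofReal_le_ofReal (le_of_eq ?_)
    have : (m : ℤ) - ((k + (m + 1) : ℕ) : ℤ) = -((k + 1 : ℕ) : ℤ) := by push_cast; ring
    rw [this, zpow_neg, zpow_natCast, pow_succ]
    field_simp

/-- The quadtree distance falls below a `1 / L` fraction of the `ℓ₁` distance with probability
exponentially small in `L`. -/
theorem measure_mul_quadDist_lt_le {d : ℕ} {M : ℤ} {x y : Fin d → ℝ} {L : ℝ} (hL : 1 ≤ L)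
    (hxy : ∑ i, |x i - y i| ≤ (2 : ℝ) ^ M) :
    (Measure.pi fun _ : Fin d => unif ((2 : ℝ) ^ M))
        {σ | L * quadDist d M σ x y < ∑ i, |x i - y i|} ≤ ENNReal.ofReal (Real.exp (-L)) := by
  have hL0 : 0 < L := by linarith
  set D := ∑ i, |x i - y i|
  have hD0 : 0 ≤ D := by positivity
  rcases hD0.eq_or_lt with h0 | hpos
  · have : {σ | L * quadDist d M σ x y < D} = ∅ := by
      ext σ
      simp only [Set.mem_ofPred_eq, Set.mem_empty_iff_false, iff_false, not_lt, ← h0]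
      exact mul_nonneg hL0.le (quadDist_nonneg d M σ x y)
    simp [this]
  obtain ⟨ℓ, h1, h2⟩ := exists_mem_Ico_zpow (div_pos hpos hL0) (one_lt_two (α := ℝ))
  have hℓ : ℓ ≤ M := by
    rw [← zpow_le_zpow_iff_right₀ (one_lt_two (α := ℝ))]
    exact h1.trans ((div_le_self hD0 hL).trans hxy)
  refine (measure_mono fun σ hσ hs => ?_).trans ((measure_not_separated_le d hℓ x y).trans
    (ENNReal.ofReal_le_ofReal (Real.exp_le_exp.2 (neg_le_neg ?_))))
  · have h3 := le_quadDist hℓ hs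
    rw [zpow_add_one₀ two_ne_zero, div_lt_iff₀ hL0] at h2
    have h4 := mul_le_mul_of_nonneg_left h3 hL0.le
    have h5 : L * quadDist d M σ x y < D := hσ
    linarith
  · rw [le_div_iff₀ hL0] at h1
    rw [le_div_iff₀ (by positivity)]
    linarith

theorem isCouplingOn_mul {α : Type*} {X : Finset α} {μ ν : α → ℝ} (hμ : IsDistOn X μ)
    (hν : IsDistOn X ν) : IsCouplingOn X μ ν fun a b => μ a * ν b := by
  refine ⟨fun a b => mul_nonneg (hμ.1 a) (hν.1 b), fun a b h => ?_, fun a => ?_, fun b => ?_⟩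
  · exact ⟨hμ.2.1 a (left_ne_zero_of_mul h), hν.2.1 b (right_ne_zero_of_mul h)⟩
  · rw [← Finset.mul_sum, hν.2.2, mul_one]
  · rw [← Finset.sum_mul, hμ.2.2, one_mul]

theorem IsCouplingOn.le_left {α : Type*} {X : Finset α} {μ ν : α → ℝ} {τ : α → α → ℝ}
    (h : IsCouplingOn X μ ν τ) (a b : α) : τ a b ≤ μ a := by
  by_cases hb : b ∈ X
  · rw [← h.2.2.1 a]
    exact Finset.single_le_sum (f := fun b => τ a b) (fun c _ => h.1 a c) hb
  · rw [← h.2.2.1 a, not_imp_comm.1 (h.2.1 a b) fun h => hb h.2]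
    exact Finset.sum_nonneg fun c _ => h.1 a c

theorem IsCouplingOn.le_right {α : Type*} {X : Finset α} {μ ν : α → ℝ} {τ : α → α → ℝ}
    (h : IsCouplingOn X μ ν τ) (a b : α) : τ a b ≤ ν b := by
  by_cases ha : a ∈ X
  · rw [← h.2.2.2 b]
    exact Finset.single_le_sum (f := fun a => τ a b) (fun c _ => h.1 c b) ha
  · rw [← h.2.2.2 b, not_imp_comm.1 (h.2.1 a b) fun h => ha h.1]
    exact Finset.sum_nonneg fun c _ => h.1 c b

theorem isCompact_isCouplingOn {α : Type*} (X : Finset α) (μ ν : α → ℝ) :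
    IsCompact {τ : α → α → ℝ | IsCouplingOn X μ ν τ} := by
  refine IsCompact.of_isClosed_subset (isCompact_univ_pi fun a => isCompact_univ_pi fun _ : α =>
    isCompact_Icc (a := 0) (b := μ a)) ?_ fun τ h a _ b _ => ⟨h.1 a b, h.le_left a b⟩
  simp only [IsCouplingOn, Set.ofPred_and, Set.ofPred_forall]
  refine IsClosed.inter ?_ (IsClosed.inter ?_ (IsClosed.inter ?_ ?_))
  · exact isClosed_iInter fun a => isClosed_iInter fun b =>
      isClosed_le continuous_const (by fun_prop)
  · refine isClosed_iInter fun a => isClosed_iInter fun b => ?_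
    by_cases h : a ∈ X ∧ b ∈ X
    · simp [h]
    · simp only [h, imp_false, not_not]
      exact isClosed_eq (by fun_prop) continuous_const
  · exact isClosed_iInter fun a => isClosed_eq (by fun_prop) continuous_const
  · exact isClosed_iInter fun b => isClosed_eq (by fun_prop) continuous_const

theorem exists_coupling_eq_WOn {α : Type*} {X : Finset α} (c : α → α → ℝ) {μ ν : α → ℝ}
    (hμ : IsDistOn X μ) (hν : IsDistOn X ν) :
    ∃ τ, IsCouplingOn X μ ν τ ∧ WOn X c μ ν = ∑ a ∈ X, ∑ b ∈ X, τ a b * c a b := by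
  have hcont : Continuous fun τ : α → α → ℝ => ∑ a ∈ X, ∑ b ∈ X, τ a b * c a b := by fun_prop
  obtain ⟨τ, hτ, hmin⟩ := (isCompact_isCouplingOn X μ ν).exists_isMinOn
    ⟨_, isCouplingOn_mul hμ hν⟩ hcont.continuousOn
  refine ⟨τ, hτ, IsLeast.csInf_eq ⟨⟨τ, hτ, rfl⟩, ?_⟩⟩
  rintro v ⟨τ', hτ', rfl⟩
  exact hmin hτ'

theorem WOn_le {α : Type*} {X : Finset α} {c : α → α → ℝ} (hc : ∀ a b, 0 ≤ c a b) {μ ν : α → ℝ}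
    {τ : α → α → ℝ} (hτ : IsCouplingOn X μ ν τ) :
    WOn X c μ ν ≤ ∑ a ∈ X, ∑ b ∈ X, τ a b * c a b := by
  refine csInf_le ⟨0, ?_⟩ ⟨τ, hτ, rfl⟩
  rintro v ⟨τ', hτ', rfl⟩
  exact Finset.sum_nonneg fun a _ => Finset.sum_nonneg fun b _ => mul_nonneg (hτ'.1 a b) (hc a b)

theorem lintegral_coupling_quadDist_le {d : ℕ} {M : ℤ} (hM : 0 ≤ M) {X : Finset (Fin d → ℝ)}
    (hsep : ∀ x ∈ X, ∀ y ∈ X, x ≠ y → 1 ≤ ∑ i, |x i - y i|)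
    {τ : (Fin d → ℝ) → (Fin d → ℝ) → ℝ} (hτ : ∀ a b, 0 ≤ τ a b) :
    ∫⁻ σ, ENNReal.ofReal (∑ a ∈ X, ∑ b ∈ X, τ a b * quadDist d M σ a b)
        ∂(Measure.pi fun _ : Fin d => unif ((2 : ℝ) ^ M))
      ≤ ENNReal.ofReal (4 * (M + 1) * ∑ a ∈ X, ∑ b ∈ X, τ a b * ∑ j, |a j - b j|) := by
  have hm := measurable_quadDist d M
  have hM' : (0 : ℝ) ≤ M := by exact_mod_cast hM
  have hnn : ∀ a b σ, 0 ≤ τ a b * quadDist d M σ a b := fun a b σ =>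
    mul_nonneg (hτ a b) (quadDist_nonneg d M σ a b)
  have hnn' : ∀ a b : Fin d → ℝ, 0 ≤ 4 * ((M : ℝ) + 1) * (τ a b * ∑ j, |a j - b j|) :=
    fun a b => mul_nonneg (by positivity) (mul_nonneg (hτ a b) (by positivity))
  simp only [Finset.mul_sum X]
  rw [ENNReal.ofReal_sum_of_nonneg fun a _ => Finset.sum_nonneg fun b _ => hnn' a b]
  simp only [ENNReal.ofReal_sum_of_nonneg fun a _ => Finset.sum_nonneg fun b _ => hnn a b _]
  rw [lintegral_finsetSum _ (by fun_prop)]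
  refine Finset.sum_le_sum fun a ha => ?_
  rw [ENNReal.ofReal_sum_of_nonneg fun b _ => hnn' a b]
  simp only [ENNReal.ofReal_sum_of_nonneg fun b _ => hnn a b _]
  rw [lintegral_finsetSum _ (by fun_prop)]
  refine Finset.sum_le_sum fun b hb => ?_
  simp only [ENNReal.ofReal_mul (hτ a b)]
  rw [lintegral_const_mul _ (by fun_prop), mul_left_comm, ENNReal.ofReal_mul (hτ a b)]
  exact mul_le_mul_right (lintegral_quadDist_le hM (hsep a ha b hb)) _

/-- Markov's inequality in a form that also covers a vanishing expectation. -/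
theorem measure_mul_lt_le {Ω : Type*} [MeasurableSpace Ω] {P : Measure Ω} {f : Ω → ℝ}
    (hf : Measurable f) {B : ℝ} (hB : 0 ≤ B) (h : ∫⁻ ω, ENNReal.ofReal (f ω) ∂P ≤ ENNReal.ofReal B)
    {K : ℝ} (hK : 0 < K) : P {ω | K * B < f ω} ≤ ENNReal.ofReal K⁻¹ := by
  rcases hB.eq_or_lt with rfl | hB
  · rw [ENNReal.ofReal_zero, nonpos_iff_eq_zero, lintegral_eq_zero_iff (by fun_prop)] at h
    refine le_of_eq_of_le (measure_mono_null ?_ (ae_iff.1 h)) zero_le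
    intro ω hω h0
    rw [Set.mem_ofPred_eq, mul_zero] at hω
    rw [Pi.zero_apply, ENNReal.ofReal_eq_zero] at h0
    linarith
  · calc P {ω | K * B < f ω} ≤ P {ω | ENNReal.ofReal (K * B) ≤ ENNReal.ofReal (f ω)} :=
          measure_mono fun ω hω => ENNReal.ofReal_le_ofReal (le_of_lt hω)
      _ ≤ ENNReal.ofReal B / ENNReal.ofReal (K * B) :=
          (meas_ge_le_lintegral_div (by fun_prop) (by simp; positivity)
            ENNReal.ofReal_ne_top).trans (ENNReal.div_le_div_right h _)
      _ = ENNReal.ofReal K⁻¹ := by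
          rw [← ENNReal.ofReal_div_of_pos (by positivity)]
          congr 1
          field_simp

theorem sq_mul_exp_neg_le {s : ℕ} (hs : 0 < s) :
    (s : ℝ) * (s * Real.exp (-(8 * (1 + Real.log s)))) ≤ 1 / 200 := by
  have hs' : (1 : ℝ) ≤ s := by exact_mod_cast hs
  have h0 := Real.log_nonneg hs'
  have h1 : Real.exp (-(8 * (1 + Real.log s))) ≤ Real.exp (-8) * ((s : ℝ)⁻¹ * (s : ℝ)⁻¹) := by
    have : (s : ℝ)⁻¹ = Real.exp (-Real.log s) := by
      rw [Real.exp_neg, Real.exp_log (by positivity)]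
    rw [this, ← Real.exp_add, ← Real.exp_add, Real.exp_le_exp]
    linarith
  have h2 : Real.exp (-8) ≤ 1 / 200 := by
    have h3 : (2 : ℝ) ^ 8 ≤ Real.exp 1 ^ 8 :=
      pow_le_pow_left₀ zero_le_two (by linarith [Real.exp_one_gt_d9]) 8
    rw [← Real.exp_nat_mul] at h3
    rw [Real.exp_neg, inv_eq_one_div]
    refine one_div_le_one_div_of_le (by norm_num) ?_
    norm_num at h3 ⊢
    linarith
  calc (s : ℝ) * (s * Real.exp (-(8 * (1 + Real.log s))))
      ≤ s * (s * (Real.exp (-8) * ((s : ℝ)⁻¹ * (s : ℝ)⁻¹))) := by gcongr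
    _ = Real.exp (-8) := by field_simp
    _ ≤ _ := h2

/-- All `ℓ₁` distances between two sets of at most `s` points are `O(log s)` times their quadtree
distances, with probability at least `1 - 1 / 200`. -/
theorem measure_exists_mul_quadDist_lt_le {d s : ℕ} {M : ℤ} (hs : 0 < s)
    {A B : Finset (Fin d → ℝ)} (hA : A.card ≤ s) (hB : B.card ≤ s)
    (hdiam : ∀ x ∈ A, ∀ y ∈ B, ∑ i, |x i - y i| ≤ (2 : ℝ) ^ M) :
    (Measure.pi fun _ : Fin d => unif ((2 : ℝ) ^ M))
        {σ | ∃ x ∈ A, ∃ y ∈ B, 8 * (1 + Real.log s) * quadDist d M σ x y < ∑ i, |x i - y i|}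
      ≤ ENNReal.ofReal (1 / 200) := by
  have hs' : (1 : ℝ) ≤ s := by exact_mod_cast hs
  have h0 := Real.log_nonneg hs'
  set L := 8 * (1 + Real.log s)
  have h : {σ | ∃ x ∈ A, ∃ y ∈ B, L * quadDist d M σ x y < ∑ i, |x i - y i|} =
      ⋃ x ∈ A, ⋃ y ∈ B, {σ | L * quadDist d M σ x y < ∑ i, |x i - y i|} := by
    ext σ; simp
  rw [h]
  calc _ ≤ ∑ x ∈ A, ∑ y ∈ B, ENNReal.ofReal (Real.exp (-L)) :=
        (measure_biUnion_finset_le _ _).trans (Finset.sum_le_sum fun x hx =>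
          (measure_biUnion_finset_le _ _).trans (Finset.sum_le_sum fun y hy =>
            measure_mul_quadDist_lt_le (by linarith) (hdiam x hx y hy)))
    _ = (A.card : ENNReal) * (B.card * ENNReal.ofReal (Real.exp (-L))) := by simp
    _ ≤ (s : ENNReal) * (s * ENNReal.ofReal (Real.exp (-L))) := by gcongr
    _ = ENNReal.ofReal (s * (s * Real.exp (-L))) := by
        rw [ENNReal.ofReal_mul (by positivity), ENNReal.ofReal_mul (by positivity),
          ENNReal.ofReal_natCast]
    _ ≤ _ := ENNReal.ofReal_le_ofReal (sq_mul_exp_neg_le hs)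

/-- The Flowtree nearest-neighbor guarantee: with probability at least 0.99 over the
random shift `σ`, for every choice of tree-optimal couplings `g_i` of `(μ_i, ν)`, any
minimizer of the Flowtree estimate `F(i) = Σ_{x,y} g_i(x,y)·‖x−y‖₁` is an
`O(log s · log(dΦ))`-approximate nearest neighbor in `W₁`, with no dependence on `n`
(here `Φ = 2^M` and the `log(dΦ)` factor is realized as `M+1` levels). -/
theorem stmt9 : ∃ C : ℝ, 0 < C ∧
    ∀ (d s n : ℕ) (M : ℤ), 0 ≤ M →
    ∀ X : Finset (Fin d → ℝ),
      (∀ x ∈ X, ∀ i, 0 ≤ x i ∧ x i ≤ (2 : ℝ) ^ M) →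
      (∀ x ∈ X, ∀ y ∈ X, x ≠ y → 1 ≤ ∑ i, |x i - y i|) →
      (∀ x ∈ X, ∀ y ∈ X, ∑ i, |x i - y i| ≤ (2 : ℝ) ^ M) →
    ∀ (μ : Fin n → (Fin d → ℝ) → ℝ) (ν : (Fin d → ℝ) → ℝ),
      (∀ i, IsDistOn X (μ i)) → IsDistOn X ν →
      (∀ i, (X.filter fun a => μ i a ≠ 0).card ≤ s) →
      (X.filter fun a => ν a ≠ 0).card ≤ s →
    ENNReal.ofReal 0.99 ≤
      (Measure.pi fun _ : Fin d => unif ((2 : ℝ) ^ M))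
        {σ : Fin d → ℝ | ∀ g : Fin n → (Fin d → ℝ) → (Fin d → ℝ) → ℝ,
          (∀ i, IsCouplingOn X (μ i) ν (g i) ∧
            ∀ τ, IsCouplingOn X (μ i) ν τ →
              (∑ a ∈ X, ∑ b ∈ X, g i a b * quadDist d M σ a b) ≤
                ∑ a ∈ X, ∑ b ∈ X, τ a b * quadDist d M σ a b) →
          ∀ i' : Fin n,
            (∀ i, (∑ a ∈ X, ∑ b ∈ X, g i' a b * ∑ j, |a j - b j|) ≤
              ∑ a ∈ X, ∑ b ∈ X, g i a b * ∑ j, |a j - b j|) →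
            ∀ i, WOn X (fun a b => ∑ j, |a j - b j|) (μ i') ν ≤
              C * (1 + Real.log (s : ℝ)) * ((M : ℝ) + 1) *
                WOn X (fun a b => ∑ j, |a j - b j|) (μ i) ν} := by
  refine ⟨6400, by norm_num, fun d s n M hM X _ hsep hdiam μ ν hμ hν hμs hνs => ?_⟩
  have := isProbabilityMeasure_unif (t := (2 : ℝ) ^ M) (by positivity)
  set P := Measure.pi fun _ : Fin d => unif ((2 : ℝ) ^ M)
  set c : (Fin d → ℝ) → (Fin d → ℝ) → ℝ := fun a b => ∑ j, |a j - b j|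
  have hc0 : ∀ a b, 0 ≤ c a b := fun a b => Finset.sum_nonneg fun j _ => abs_nonneg _
  rcases isEmpty_or_nonempty (Fin n) with hn | hn
  · refine le_of_le_of_eq (b := 1) (by simp; norm_num) ?_
    rw [← measure_univ (μ := P)]
    congr 1
    ext σ
    simp
  have hs : 0 < s := by
    obtain ⟨a, ha, h⟩ := Finset.exists_ne_zero_of_sum_ne_zero (hν.2.2.trans_ne one_ne_zero)
    exact (Finset.card_pos.2 ⟨a, Finset.mem_filter.2 ⟨ha, h⟩⟩).trans_le hνs
  have hlog : 0 ≤ Real.log s := Real.log_nonneg (by exact_mod_cast hs)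
  have hM' : (0 : ℝ) ≤ M := by exact_mod_cast hM
  obtain ⟨i₀, hi₀⟩ := Finite.exists_min fun i => WOn X c (μ i) ν
  obtain ⟨τ, hτ, hW⟩ := exists_coupling_eq_WOn c (hμ i₀) hν
  set W := WOn X c (μ i₀) ν
  have hW0 : 0 ≤ W := hW ▸ Finset.sum_nonneg fun a _ => Finset.sum_nonneg fun b _ =>
    mul_nonneg (hτ.1 a b) (hc0 a b)
  set B₁ : Set (Fin d → ℝ) := {σ | 200 * (4 * ((M : ℝ) + 1) * W)
    < ∑ a ∈ X, ∑ b ∈ X, τ a b * quadDist d M σ a b}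
  set B₂ : Set (Fin d → ℝ) := {σ | ∃ x ∈ X.filter fun a => μ i₀ a ≠ 0,
    ∃ y ∈ X.filter fun a => ν a ≠ 0,
      8 * (1 + Real.log s) * quadDist d M σ x y < ∑ i, |x i - y i|}
  have h₁ : P B₁ ≤ ENNReal.ofReal (1 / 200) := by
    have hm := measurable_quadDist d M
    rw [one_div]
    refine measure_mul_lt_le (by fun_prop) (by positivity) ?_ (by norm_num)
    rw [hW]
    exact lintegral_coupling_quadDist_le hM hsep hτ.1
  have h₂ : P B₂ ≤ ENNReal.ofReal (1 / 200) :=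
    measure_exists_mul_quadDist_lt_le hs (hμs i₀) hνs fun x hx y hy =>
      hdiam x (Finset.mem_filter.1 hx).1 y (Finset.mem_filter.1 hy).1
  have hbad : P (B₁ ∪ B₂) ≤ ENNReal.ofReal 0.01 := by
    refine (measure_union_le _ _).trans ((add_le_add h₁ h₂).trans ?_)
    rw [← ENNReal.ofReal_add (by norm_num) (by norm_num)]
    exact ENNReal.ofReal_le_ofReal (by norm_num)
  have hgood : ENNReal.ofReal 0.99 ≤ P (B₁ ∪ B₂)ᶜ := by
    have h3 : 1 ≤ P (B₁ ∪ B₂) + P (B₁ ∪ B₂)ᶜ := by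
      rw [← measure_univ (μ := P), ← Set.union_compl_self (B₁ ∪ B₂)]
      exact measure_union_le _ _
    refine (ENNReal.add_le_add_iff_left (a := ENNReal.ofReal 0.01) ENNReal.ofReal_ne_top).1 ?_
    rw [← ENNReal.ofReal_add (by norm_num) (by norm_num)]
    refine le_trans (by norm_num) (h3.trans (add_le_add_left hbad _))
  refine hgood.trans (measure_mono fun σ hσ g hg i' hi' i => ?_)
  rw [Set.mem_compl_iff, Set.mem_union, not_or] at hσ
  have hcost : ∑ a ∈ X, ∑ b ∈ X, τ a b * quadDist d M σ a b ≤ 200 * (4 * ((M : ℝ) + 1) * W) :=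
    not_lt.1 hσ.1
  have hdist : ∀ a b, g i₀ a b * c a b ≤
      8 * (1 + Real.log s) * (g i₀ a b * quadDist d M σ a b) := fun a b => by
    obtain ⟨hgc, -⟩ := hg i₀
    rcases (hgc.1 a b).eq_or_lt with h | h
    · simp [← h]
    · have hab := hgc.2.1 a b h.ne'
      have h4 : c a b ≤ 8 * (1 + Real.log s) * quadDist d M σ a b := by
        by_contra! hlt
        exact hσ.2 ⟨a, Finset.mem_filter.2 ⟨hab.1, (h.trans_le (hgc.le_left a b)).ne'⟩,
          b, Finset.mem_filter.2 ⟨hab.2, (h.trans_le (hgc.le_right a b)).ne'⟩, hlt⟩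
      rw [mul_left_comm]
      exact mul_le_mul_of_nonneg_left h4 h.le
  calc WOn X c (μ i') ν ≤ ∑ a ∈ X, ∑ b ∈ X, g i' a b * c a b := WOn_le hc0 (hg i').1
    _ ≤ ∑ a ∈ X, ∑ b ∈ X, g i₀ a b * c a b := hi' i₀
    _ ≤ 8 * (1 + Real.log s) * ∑ a ∈ X, ∑ b ∈ X, g i₀ a b * quadDist d M σ a b := by
        simp only [Finset.mul_sum X]
        exact Finset.sum_le_sum fun a _ => Finset.sum_le_sum fun b _ => hdist a b
    _ ≤ 8 * (1 + Real.log s) * (200 * (4 * ((M : ℝ) + 1) * W)) :=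
        mul_le_mul_of_nonneg_left (((hg i₀).2 τ hτ).trans hcost) (by positivity)
    _ = 6400 * (1 + Real.log s) * ((M : ℝ) + 1) * W := by ring
    _ ≤ _ := mul_le_mul_of_nonneg_left (hi₀ i) (by positivity)
end

section
/- Let d ≥ 2 be an even integer and let σ ∈ ℝ^d be random with i.i.d. coordinates uniformly distributed on [0, 2]. Then with probability at least 1/2, there are at least d/2 indices i ∈ {1,…,d} with ⌊σ_i/2⌋ = ⌊(1+σ_i)/2⌋; and on this event there exists z ∈ {0,1}^d with Σ_i z_i = d/2 such that ⌊(z_i+σ_i)/2⌋ = ⌊σ_i/2⌋ for every i ∈ {1,…,d}, i.e., z lies in the same side-2 grid cell as the origin. -/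
open MeasureTheory
open scoped Classical

instance isProbabilityMeasure_unif_two : IsProbabilityMeasure (unif 2) := by
  refine ⟨?_⟩
  simp only [unif, Measure.smul_apply, Measure.restrict_apply_univ, Real.volume_Icc, sub_zero,
    smul_eq_mul]
  exact ENNReal.inv_mul_cancel (by simp) ENNReal.ofReal_ne_top

/-- The uniform measure on `[0, t]` is invariant under the reflection `x ↦ t - x`. -/
theorem measurePreserving_sub_left_unif (t : ℝ) :
    MeasurePreserving (fun x : ℝ => t - x) (unif t) (unif t) := by
  have h := ((volume : Measure ℝ).measurePreserving_sub_left t).restrict_preimage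
    (measurableSet_Icc (a := 0) (b := t))
  have hs : (fun x : ℝ => t - x) ⁻¹' Set.Icc 0 t = Set.Icc 0 t := by simp
  rw [hs] at h
  exact h.smul_measure _

theorem floor_half_eq_iff_of_mem_Ico {x : ℝ} (hx : x ∈ Set.Ico (0 : ℝ) 2) :
    ⌊x / 2⌋ = ⌊(1 + x) / 2⌋ ↔ x < 1 := by
  have h0 : ⌊x / 2⌋ = 0 := Int.floor_eq_zero_iff.2 ⟨by linarith [hx.1], by linarith [hx.2]⟩
  rw [h0, eq_comm, Int.floor_eq_zero_iff]
  exact ⟨fun h => by linarith [h.2], fun h => ⟨by linarith [hx.1], by linarith⟩⟩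

/-- Almost surely, an axis that is cut becomes uncut after reflecting the shift. -/
theorem ae_unif_two_floor_half_reflect :
    ∀ᵐ x ∂unif 2, ⌊x / 2⌋ ≠ ⌊(1 + x) / 2⌋ → ⌊(2 - x) / 2⌋ = ⌊(1 + (2 - x)) / 2⌋ := by
  refine Measure.ae_smul_measure ?_ _
  filter_upwards [ae_restrict_mem measurableSet_Icc, Measure.ae_ne _ 0, Measure.ae_ne _ 1,
    Measure.ae_ne _ 2] with x hx h0 h1 h2 hcut
  have hx0 : 0 < x := lt_of_le_of_ne hx.1 (Ne.symm h0)
  have hx2 : x < 2 := lt_of_le_of_ne hx.2 h2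
  rw [Ne, floor_half_eq_iff_of_mem_Ico ⟨hx.1, hx2⟩, not_lt] at hcut
  have hx1 : 1 < x := lt_of_le_of_ne hcut (Ne.symm h1)
  exact (floor_half_eq_iff_of_mem_Ico ⟨by linarith, by linarith⟩).2 (by linarith)

/-- Combinatorial core of the Ω(log n) lower bound for Quadtree.
For even `d ≥ 2` and `σ ∈ ℝ^d` with i.i.d. coordinates uniform on `[0,2]`:
with probability at least 1/2, at least `d/2` axes `i` are uncut, i.e.
`⌊σᵢ/2⌋ = ⌊(1+σᵢ)/2⌋`; and whenever at least `d/2` axes are uncut, there exists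
`z ∈ {0,1}^d` with `Σᵢ zᵢ = d/2` lying in the same side-2 grid cell as the origin, i.e.
`⌊(zᵢ+σᵢ)/2⌋ = ⌊σᵢ/2⌋` for every `i`. -/
theorem stmt12 (d : ℕ) (hd2 : 2 ≤ d) (hdeven : Even d) :
    (ENNReal.ofReal (1 / 2) ≤
      (Measure.pi fun _ : Fin d => unif 2)
        {σ : Fin d → ℝ | d / 2 ≤
          (Finset.univ.filter fun i : Fin d => ⌊σ i / 2⌋ = ⌊(1 + σ i) / 2⌋).card}) ∧
    ∀ σ : Fin d → ℝ,
      d / 2 ≤ (Finset.univ.filter fun i : Fin d => ⌊σ i / 2⌋ = ⌊(1 + σ i) / 2⌋).card →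
      ∃ z : Fin d → ℝ, (∀ i, z i = 0 ∨ z i = 1) ∧ (∑ i, z i) = (d : ℝ) / 2 ∧
        ∀ i, ⌊(z i + σ i) / 2⌋ = ⌊σ i / 2⌋ := by
  refine ⟨?_, fun σ hσ => ?_⟩
  · set μ := Measure.pi fun _ : Fin d => unif 2
    set A := {σ : Fin d → ℝ | d / 2 ≤
      (Finset.univ.filter fun i : Fin d => ⌊σ i / 2⌋ = ⌊(1 + σ i) / 2⌋).card} with hA
    have hR : MeasurePreserving (MeasurableEquiv.piCongrRight
        fun _ : Fin d => MeasurableEquiv.subLeft (2 : ℝ)) μ μ :=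
      measurePreserving_pi _ _ fun _ => measurePreserving_sub_left_unif 2
    have hae : ∀ᵐ σ ∂μ, ∀ i, ⌊σ i / 2⌋ ≠ ⌊(1 + σ i) / 2⌋ →
        ⌊(2 - σ i) / 2⌋ = ⌊(1 + (2 - σ i)) / 2⌋ :=
      ae_all_iff.2 fun i => (Measure.tendsto_eval_ae_ae (μ := fun _ : Fin d => unif 2) (i := i)).eventually
        ae_unif_two_floor_half_reflect
    have hle : μ Aᶜ ≤ μ A := by
      rw [← hR.measure_preimage_equiv A]
      refine measure_mono_ae ?_
      filter_upwards [hae] with σ hσ hσA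
      have hlt : (Finset.univ.filter fun i : Fin d => ⌊σ i / 2⌋ = ⌊(1 + σ i) / 2⌋).card < d / 2 :=
        not_le.1 hσA
      change d / 2 ≤ (Finset.univ.filter fun i : Fin d =>
        ⌊(2 - σ i) / 2⌋ = ⌊(1 + (2 - σ i)) / 2⌋).card
      have hcard := Finset.card_filter_add_card_filter_not (s := Finset.univ)
        (fun i : Fin d => ⌊σ i / 2⌋ = ⌊(1 + σ i) / 2⌋)
      have hsub := Finset.card_le_card (Finset.monotone_filter_right (Finset.univ)
        (fun i _ => hσ i))
      rw [Finset.card_univ, Fintype.card_fin] at hcard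
      simp only [ne_eq] at hsub
      omega
    have h1 : 1 ≤ μ A * 2 := by
      calc 1 = μ (A ∪ Aᶜ) := by rw [Set.union_compl_self, measure_univ]
        _ ≤ μ A + μ Aᶜ := measure_union_le _ _
        _ ≤ μ A * 2 := by rw [mul_two]; gcongr
    rw [ENNReal.ofReal_div_of_pos two_pos, ENNReal.ofReal_one, ENNReal.ofReal_ofNat]
    exact ENNReal.div_le_of_le_mul h1
  · obtain ⟨t, hts, htc⟩ := Finset.exists_subset_card_eq hσ
    refine ⟨fun i => if i ∈ t then 1 else 0, fun i => ?_, ?_, fun i => ?_⟩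
    · by_cases h : i ∈ t <;> simp [h]
    · rw [Finset.sum_boole, Finset.filter_mem_eq_inter, Finset.univ_inter, htc,
        Nat.cast_div hdeven.two_dvd two_ne_zero, Nat.cast_ofNat]
    · by_cases h : i ∈ t
      · simpa [h] using (Finset.mem_filter.1 (hts h)).2.symm
      · simp [h]
end

section
/- Let d ∈ ℕ, let M be an integer, let ε ∈ (0, 1/2], and let σ ∈ ℝ^d be random with i.i.d. coordinates uniformly distributed on [0, 2^M]. Then for every δ ∈ (0, 1/e] and all x, y ∈ ℝ^d with 0 < ‖x−y‖₁ ≤ 2^M, the probability that T'_σ(x,y) < ‖x−y‖₁^{1−ε} / ln(1/δ) is at most δ. -/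
open MeasureTheory
open scoped Classical

/-- The ε-snowflaked quadtree distance
`T'_σ(x,y) = 2 ⬝ Σ_{ℓ ≤ M} 2^{ℓ(1−ε)} ⬝ 1[x, y separated at level ℓ]`. -/
noncomputable def quadDistSnow (d : ℕ) (M : ℤ) (ε : ℝ) (σ x y : Fin d → ℝ) : ℝ :=
  2 * ∑' ℓ : ℤ, if ℓ ≤ M ∧ Separated d σ ℓ x y then (2 : ℝ) ^ ((ℓ : ℝ) * (1 - ε)) else 0

/-- The shifts that leave `a` and `b` in the same cell of the grid of side `w`. -/
def sameCell (w a b : ℝ) : Set ℝ := {s | ⌊(a + s) / w⌋ = ⌊(b + s) / w⌋}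

lemma sameCell_comm (w a b : ℝ) : sameCell w a b = sameCell w b a := by
  ext s
  exact eq_comm

lemma measurableSet_sameCell (w a b : ℝ) : MeasurableSet (sameCell w a b) :=
  measurableSet_eq_fun (by fun_prop) (by fun_prop)

lemma add_mem_sameCell_iff {w : ℝ} (hw : 0 < w) (a b s : ℝ) :
    s + w ∈ sameCell w a b ↔ s ∈ sameCell w a b := by
  have key : ∀ c : ℝ, ⌊(c + (s + w)) / w⌋ = ⌊(c + s) / w⌋ + 1 := by
    intro c
    rw [← Int.floor_add_one]
    congr 1
    field_simp
    ring
  simp only [sameCell, Set.mem_ofPred_eq, key, add_left_inj]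

lemma measureReal_sameCell_period_le {w a b : ℝ} (hw : 0 < w) :
    (volume.restrict (Set.Ioc (-a) (-a + w))).real (sameCell w a b) ≤
      w * Real.exp (-((b - a) / w)) := by
  have hsub : sameCell w a b ∩ Set.Ioc (-a) (-a + w) ⊆ Set.Ioc (-a) (w - b) ∪ {-a + w} := by
    rintro s ⟨hs, hs1, hs2⟩
    rcases hs2.eq_or_lt with h | h
    · exact Or.inr h
    · refine Or.inl ⟨hs1, ?_⟩
      have hfa : ⌊(a + s) / w⌋ = 0 := by
        rw [Int.floor_eq_zero_iff]
        exact ⟨div_nonneg (by linarith) hw.le, (div_lt_one hw).2 (by linarith)⟩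
      have hfb : ⌊(b + s) / w⌋ = 0 := hs.symm.trans hfa
      rw [Int.floor_eq_zero_iff] at hfb
      have := (div_lt_one hw).1 hfb.2
      linarith
  have hexp : w - b - -a ≤ w * Real.exp (-((b - a) / w)) := by
    calc w - b - -a = w * (-((b - a) / w) + 1) := by field_simp; ring
      _ ≤ _ := mul_le_mul_of_nonneg_left (Real.add_one_le_exp _) hw.le
  rw [measureReal_restrict_apply (measurableSet_sameCell w a b), measureReal_def]
  refine ENNReal.toReal_le_of_le_ofReal (by positivity) ?_
  calc volume (sameCell w a b ∩ Set.Ioc (-a) (-a + w))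
      ≤ volume (Set.Ioc (-a) (w - b)) + volume {-a + w} :=
        (measure_mono hsub).trans (measure_union_le _ _)
    _ = ENNReal.ofReal (w - b - -a) := by simp
    _ ≤ _ := ENNReal.ofReal_le_ofReal hexp

lemma measureReal_sameCell_le {w a b : ℝ} (hw : 0 < w) (n : ℕ) :
    (volume.restrict (Set.Ioc 0 (n * w))).real (sameCell w a b) ≤
      n * w * Real.exp (-((b - a) / w)) := by
  set f : ℝ → ℝ := (sameCell w a b).indicator 1 with hf
  have hm := measurableSet_sameCell w a b
  have hper : Function.Periodic f w := by
    intro s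
    simp only [hf, Set.indicator_apply, add_mem_sameCell_iff hw]
    rfl
  have hint : ∀ t₁ t₂, IntervalIntegrable f volume t₁ t₂ := by
    intro t₁ t₂
    rw [intervalIntegrable_iff]
    exact IntegrableOn.indicator (integrableOn_const (C := (1 : ℝ)) (by simp [Set.uIoc])) hm
  have hinterval : ∀ t₁ t₂, t₁ ≤ t₂ →
      ∫ s in t₁..t₂, f s = (volume.restrict (Set.Ioc t₁ t₂)).real (sameCell w a b) := by
    intro t₁ t₂ h
    rw [intervalIntegral.integral_of_le h, hf, integral_indicator_one hm]
  have hsum := hper.intervalIntegral_add_zsmul_eq n 0 hint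
  have hshift := hper.intervalIntegral_add_eq 0 (-a)
  rw [hshift, hinterval (-a) _ (by linarith)] at hsum
  simp only [zero_add, natCast_zsmul, nsmul_eq_mul] at hsum
  rw [hinterval 0 _ (by positivity)] at hsum
  rw [hsum, mul_assoc]
  exact mul_le_mul_of_nonneg_left (measureReal_sameCell_period_le hw) n.cast_nonneg

lemma unif_sameCell_le {w : ℝ} (hw : 0 < w) {n : ℕ} (hn : 0 < n) (a b : ℝ) :
    unif (n * w) (sameCell w a b) ≤ ENNReal.ofReal (Real.exp (-(|a - b| / w))) := by
  wlog hab : a ≤ b generalizing a b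
  · rw [sameCell_comm, abs_sub_comm]
    exact this b a (le_of_not_ge hab)
  have hpos : 0 < n * w := by positivity
  rw [unif, Measure.smul_apply, smul_eq_mul, Measure.restrict_congr_set Ioc_ae_eq_Icc.symm,
    ← ENNReal.ofReal_inv_of_pos hpos, ← ofReal_measureReal,
    ← ENNReal.ofReal_mul (by positivity), abs_of_nonpos (by linarith), neg_sub]
  refine ENNReal.ofReal_le_ofReal ?_
  rw [inv_mul_le_iff₀ hpos]
  exact measureReal_sameCell_le hw n

lemma pi_not_separated_le {d : ℕ} {ℓ M : ℤ} (hℓ : ℓ ≤ M) (x y : Fin d → ℝ) :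
    (Measure.pi fun _ : Fin d => unif ((2 : ℝ) ^ M)) {σ | ¬ Separated d σ ℓ x y} ≤
      ENNReal.ofReal (Real.exp (-((∑ i, |x i - y i|) / (2 : ℝ) ^ ℓ))) := by
  obtain ⟨k, rfl⟩ := Int.le.dest hℓ
  have hw : (0 : ℝ) < 2 ^ ℓ := by positivity
  have hM : (2 : ℝ) ^ (ℓ + k) = ((2 ^ k : ℕ) : ℝ) * 2 ^ ℓ := by
    rw [zpow_add₀ two_ne_zero, zpow_natCast, mul_comm]
    push_cast
    rfl
  have : IsFiniteMeasure (unif ((2 : ℝ) ^ (ℓ + (k : ℤ)))) :=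
    Measure.smul_finite _ (by simp; positivity)
  have hset : {σ | ¬ Separated d σ ℓ x y} =
      Set.univ.pi fun i => sameCell ((2 : ℝ) ^ ℓ) (x i) (y i) := by
    ext σ
    simp [Separated, sameCell]
  rw [hset, Measure.pi_pi, Finset.sum_div, ← Finset.sum_neg_distrib, Real.exp_sum,
    ENNReal.ofReal_prod_of_nonneg fun i _ => (Real.exp_pos _).le]
  refine Finset.prod_le_prod' fun i _ => ?_
  rw [hM]
  exact unif_sameCell_le hw (by positivity) _ _

lemma two_mul_rpow_le_quadDistSnow {d : ℕ} {ℓ M : ℤ} (hℓ : ℓ ≤ M) {ε : ℝ} (hε : ε < 1)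
    {σ x y : Fin d → ℝ} (hsep : Separated d σ ℓ x y) :
    2 * (2 : ℝ) ^ ((ℓ : ℝ) * (1 - ε)) ≤ quadDistSnow d M ε σ x y := by
  set g : ℤ → ℝ := fun ℓ =>
    if ℓ ≤ M ∧ Separated d σ ℓ x y then (2 : ℝ) ^ ((ℓ : ℝ) * (1 - ε)) else 0 with hg
  have hnonneg : ∀ ℓ, 0 ≤ g ℓ := by
    intro ℓ
    simp only [hg]
    split_ifs <;> positivity
  have hle : ∀ ℓ, g ℓ ≤ (2 : ℝ) ^ ((ℓ : ℝ) * (1 - ε)) := by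
    intro ℓ
    simp only [hg]
    split_ifs
    · exact le_rfl
    · positivity
  have hinj : Function.Injective fun n : ℕ => M - (n : ℤ) := by
    intro m n h
    simpa using h
  have hsummable : Summable g := by
    rw [← hinj.summable_iff]
    · refine Summable.of_nonneg_of_le (fun n => hnonneg _) (fun n => hle _) ?_
      have hgeom : Summable fun n : ℕ =>
          (2 : ℝ) ^ ((M : ℝ) * (1 - ε)) * ((2 : ℝ) ^ (-(1 - ε))) ^ n :=
        (summable_geometric_of_lt_one (by positivity)
          (Real.rpow_lt_one_of_one_lt_of_neg one_lt_two (by linarith))).mul_left _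
      refine hgeom.congr fun n => ?_
      rw [← Real.rpow_natCast, ← Real.rpow_mul zero_le_two, ← Real.rpow_add two_pos]
      congr 1
      push_cast
      ring
    · intro ℓ hnot
      refine if_neg fun h => hnot ⟨(M - ℓ).toNat, ?_⟩
      have := h.1
      simp only
      omega
  have hterm : g ℓ = (2 : ℝ) ^ ((ℓ : ℝ) * (1 - ε)) := if_pos ⟨hℓ, hsep⟩
  rw [← hterm]
  exact mul_le_mul_of_nonneg_left (hsummable.le_tsum ℓ fun j _ => hnonneg j) zero_le_two

lemma rpow_div_le_two_mul_rpow {D s ε : ℝ} {ℓ : ℤ} (hD : 0 < D) (hs : 1 ≤ s) (hε0 : 0 ≤ ε)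
    (hε1 : ε ≤ 1) (hℓ : D / s ≤ (2 : ℝ) ^ (ℓ + 1)) :
    D ^ (1 - ε) / s ≤ 2 * (2 : ℝ) ^ ((ℓ : ℝ) * (1 - ε)) := by
  have hs0 : 0 < s := by linarith
  calc D ^ (1 - ε) / s ≤ D ^ (1 - ε) / s ^ (1 - ε) := by
        gcongr
        exact Real.rpow_le_self_of_one_le hs (by linarith)
    _ = (D / s) ^ (1 - ε) := (Real.div_rpow hD.le hs0.le _).symm
    _ ≤ ((2 : ℝ) ^ (ℓ + 1)) ^ (1 - ε) := by
        gcongr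
    _ = 2 ^ (1 - ε) * (2 : ℝ) ^ ((ℓ : ℝ) * (1 - ε)) := by
        rw [← Real.rpow_intCast, ← Real.rpow_mul zero_le_two, ← Real.rpow_add two_pos]
        congr 1
        push_cast
        ring
    _ ≤ 2 * (2 : ℝ) ^ ((ℓ : ℝ) * (1 - ε)) := by
        gcongr
        exact Real.rpow_le_self_of_one_le one_le_two (by linarith)

/-- For any integer `M`, `ε ∈ (0, 1/2]`, and `σ ∈ ℝ^d` with i.i.d. coordinates uniform
on `[0, 2^M]`: for every `δ ∈ (0, 1/e]` and all `x, y ∈ ℝ^d` with `0 < ‖x−y‖₁ ≤ 2^M`,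
the probability that `T'_σ(x,y) < ‖x−y‖₁^{1−ε} / ln(1/δ)` is at most `δ`. -/
theorem stmt15 (d : ℕ) (M : ℤ) (ε : ℝ) (hε : ε ∈ Set.Ioc (0 : ℝ) (1 / 2))
    (δ : ℝ) (hδ0 : 0 < δ) (hδ1 : δ ≤ Real.exp (-1))
    (x y : Fin d → ℝ)
    (h0 : 0 < ∑ i, |x i - y i|) (h1 : ∑ i, |x i - y i| ≤ (2 : ℝ) ^ M) :
    (Measure.pi fun _ : Fin d => unif ((2 : ℝ) ^ M))
        {σ : Fin d → ℝ |
          quadDistSnow d M ε σ x y < (∑ i, |x i - y i|) ^ (1 - ε) / Real.log (1 / δ)} ≤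
      ENNReal.ofReal δ := by
  set D := ∑ i, |x i - y i| with hD
  set s := Real.log (1 / δ) with hs
  have hs_neg : s = -Real.log δ := by rw [hs, one_div, Real.log_inv]
  have hs1 : 1 ≤ s := by
    have := (Real.log_le_iff_le_exp hδ0).2 hδ1
    linarith
  have hs0 : 0 < s := by linarith
  have hDs : 0 < D / s := div_pos h0 hs0
  set ℓ := Int.log 2 (D / s)
  have hlow : (2 : ℝ) ^ ℓ ≤ D / s := by
    exact_mod_cast Int.zpow_log_le_self one_lt_two hDs
  have hupp : D / s ≤ (2 : ℝ) ^ (ℓ + 1) := by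
    exact_mod_cast (Int.lt_zpow_succ_log_self one_lt_two (D / s)).le
  have hℓM : ℓ ≤ M :=
    (zpow_le_zpow_iff_right₀ (one_lt_two (α := ℝ))).1
      (hlow.trans ((div_le_self h0.le hs1).trans h1))
  have hsub : {σ : Fin d → ℝ | quadDistSnow d M ε σ x y < D ^ (1 - ε) / s} ⊆
      {σ | ¬ Separated d σ ℓ x y} := fun σ hσ hsep =>
    absurd ((rpow_div_le_two_mul_rpow h0 hs1 hε.1.le (by linarith [hε.2]) hupp).trans
      (two_mul_rpow_le_quadDistSnow hℓM (by linarith [hε.2]) hsep)) (not_le.2 hσ)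
  refine (measure_mono hsub).trans ((pi_not_separated_le hℓM x y).trans ?_)
  refine ENNReal.ofReal_le_ofReal ?_
  rw [← Real.le_log_iff_exp_le hδ0]
  have : s ≤ D / (2 : ℝ) ^ ℓ := by
    rw [le_div_iff₀ (by positivity), mul_comm]
    exact (le_div_iff₀ hs0).1 hlow
  linarith
end
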